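/- arXiv:2404.03272 — 5 statements merged into one kernel-verified Lean document; each statement's English description precedes it below -/
import Mathlib

section
/- There exists a constant C > 0 such that for any γ > 1 and σ > 0 with γσ < C, the total variation distance between the σ-smoothed discrete Gaussian A_γ^σ on (1/γ)ℤ and N(0, 1/(2π)) is greater than 1/2. -/
open Real

/-- Gaussian mass of the lattice `(1/γ)ℤ`. -/
noncomputable def latticeMass (γ : ℝ) : ℝ :=
  ∑' k : ℤ, Real.exp (-Real.pi * ((k : ℝ) / γ) ^ 2)

/-- Likelihood ratio `T_γ^σ` of the σ-smoothed discrete Gaussian on `(1/γ)ℤ`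
with respect to `Q = N(0, 1/(2π))` (whose Lebesgue density is `exp(-πz²)`). -/
noncomputable def pancakeLR (γ σ z : ℝ) : ℝ :=
  (Real.sqrt (1 + σ ^ 2) / (σ * latticeMass γ)) *
    ∑' k : ℤ, Real.exp (-Real.pi * (z - Real.sqrt (1 + σ ^ 2) * (k : ℝ) / γ) ^ 2 / σ ^ 2)

open MeasureTheory

lemma aux_gauss_cos (a : ℝ) :
    ∫ x : ℝ, Real.exp (-Real.pi * x ^ 2) * Real.cos (2 * Real.pi * a * x) =
      Real.exp (-Real.pi * a ^ 2) := by
  have h := fourierIntegral_gaussian (b := (Real.pi : ℂ)) (by simpa using Real.pi_pos)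
    ((2 * Real.pi * a : ℝ) : ℂ)
  have hpi : (Real.pi : ℂ) ≠ 0 := by exact_mod_cast Real.pi_ne_zero
  have e1 : ((Real.pi : ℂ) / Real.pi) ^ (1 / 2 : ℂ) = 1 := by
    rw [div_self hpi]; simp
  rw [e1, one_mul] at h
  have e2 : -(((2 * Real.pi * a : ℝ) : ℂ)) ^ 2 / (4 * (Real.pi : ℂ)) =
      ((-Real.pi * a ^ 2 : ℝ) : ℂ) := by
    push_cast; field_simp; ring
  rw [e2] at h
  have hI : Integrable (fun x : ℝ => Complex.exp (Complex.I * ((2 * Real.pi * a : ℝ) : ℂ) * x) *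
      Complex.exp (-Real.pi * (x : ℂ) ^ 2)) := by
    by_contra hc
    rw [integral_undef hc] at h
    exact Complex.exp_ne_zero _ (by rw [← h])
  have h2 := congrArg Complex.re h
  have h3 := integral_re hI
  simp only [RCLike.re_to_complex] at h3
  rw [← h3] at h2
  rw [← Complex.ofReal_exp, Complex.ofReal_re] at h2
  rw [← h2]
  congr 1
  ext x
  have e3 : Complex.I * ((2 * Real.pi * a : ℝ) : ℂ) * x = ((2 * Real.pi * a * x : ℝ) : ℂ) * Complex.I := by
    push_cast; ring
  have e4 : -(Real.pi : ℂ) * (x : ℂ) ^ 2 = ((-Real.pi * x ^ 2 : ℝ) : ℂ) := by push_cast; ring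
  rw [e3, e4, ← Complex.ofReal_exp, Complex.re_mul_ofReal, Complex.exp_ofReal_mul_I_re, mul_comm]

lemma aux_summable (γ : ℝ) (hγ : 0 < γ) :
    Summable fun k : ℤ => Real.exp (-Real.pi * ((k : ℝ) / γ) ^ 2) := by
  have h := summable_pow_mul_jacobiTheta₂_term_bound 0 (T := 1 / γ ^ 2) (by positivity) 0
  refine h.congr fun k => ?_
  rw [pow_zero, one_mul]
  congr 1
  field_simp
  ring

lemma aux_mix (w d : ℤ → ℝ) (hw : Summable w) (c : ℝ) (hc : 0 < c)
    (h : ℝ → ℝ) (hh : Integrable h) :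
    ∫ z : ℝ, ∑' k : ℤ, w k * h (z * c - d k) = (∑' k, w k) * (c⁻¹ * ∫ u, h u) := by
  have key : ∀ (g : ℝ → ℝ) (e : ℝ), ∫ z : ℝ, g (z * c - e) = c⁻¹ * ∫ u, g u := by
    intro g e
    have := Measure.integral_comp_mul_right (fun u => g (u - e)) c
    rw [this, integral_sub_right_eq_self, abs_of_pos (inv_pos.2 hc), smul_eq_mul]
  rw [← integral_tsum_of_summable_integral_norm]
  · simp_rw [integral_const_mul, key]
    rw [tsum_mul_right]
  · intro k
    exact ((hh.comp_sub_right (d k)).comp_mul_right' hc.ne').const_mul _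
  · simp_rw [norm_mul, integral_const_mul, key (fun u => ‖h u‖)]
    apply Summable.mul_right
    exact hw.norm

lemma aux_char (γ σ : ℝ) (hγ : 1 < γ) (hσ : 0 < σ) (j : ℕ) :
    ∫ z : ℝ, Real.exp (-Real.pi * z ^ 2) * pancakeLR γ σ z *
        Real.cos (2 * Real.pi * (j * γ * Real.sqrt (1 + σ ^ 2)) * z) =
      Real.exp (-Real.pi * (j * γ * σ) ^ 2) := by
  have hγ0 : 0 < γ := by linarith
  set s := Real.sqrt (1 + σ ^ 2) with hs
  have hs0 : 0 < s := by positivity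
  have hs2 : s ^ 2 = 1 + σ ^ 2 := Real.sq_sqrt (by positivity)
  have hsum := aux_summable γ hγ0
  have hM : 0 < latticeMass γ := hsum.tsum_pos (fun _ => (Real.exp_pos _).le) 0 (Real.exp_pos _)
  have hh : Integrable (fun x : ℝ => Real.exp (-Real.pi * x ^ 2) *
      Real.cos (2 * Real.pi * (j * γ * σ) * x)) := by
    by_contra hc
    have := aux_gauss_cos (j * γ * σ)
    rw [integral_undef hc] at this
    exact (Real.exp_pos _).ne this
  have hmix := aux_mix _ (fun k => k / (γ * σ)) hsum (s / σ)
    (by positivity) _ hh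
  rw [aux_gauss_cos] at hmix
  have hpt : ∀ z : ℝ, Real.exp (-Real.pi * z ^ 2) * pancakeLR γ σ z *
        Real.cos (2 * Real.pi * (j * γ * s) * z) = (s / (σ * latticeMass γ)) *
        ∑' k : ℤ, Real.exp (-Real.pi * ((k : ℝ) / γ) ^ 2) *
          (Real.exp (-Real.pi * (z * (s / σ) - k / (γ * σ)) ^ 2) *
      Real.cos (2 * Real.pi * (j * γ * σ) * (z * (s / σ) - k / (γ * σ)))) := by
    intro z
    unfold pancakeLR
    rw [← hs, mul_left_comm, mul_assoc (s / (σ * latticeMass γ)), ← tsum_mul_left, ← tsum_mul_right]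
    congr 2
    ext k
    have hcos : Real.cos (2 * Real.pi * (j * γ * σ) * (z * (s / σ) - k / (γ * σ))) =
        Real.cos (2 * Real.pi * (j * γ * s) * z) := by
      rw [← Real.cos_add_int_mul_two_pi _ ((j : ℤ) * k)]
      congr 1
      push_cast
      field_simp
      ring
    have hexp : Real.exp (-Real.pi * z ^ 2) *
        Real.exp (-Real.pi * (z - s * (k : ℝ) / γ) ^ 2 / σ ^ 2) =
        Real.exp (-Real.pi * ((k : ℝ) / γ) ^ 2) *
          Real.exp (-Real.pi * (z * (s / σ) - k / (γ * σ)) ^ 2) := by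
      rw [← Real.exp_add, ← Real.exp_add]
      congr 1
      field_simp
      have : σ ^ 2 = s ^ 2 - 1 := by linarith
      rw [this]
      ring
    rw [hcos, hexp, mul_assoc]
  simp_rw [hpt]
  rw [integral_const_mul, hmix]
  change s / (σ * latticeMass γ) * (latticeMass γ * _) = _
  field_simp

/-- TV lower bound: there is a constant `C > 0` such that whenever `γ > 1`, `σ > 0`
and `γσ < C`, the total variation distance
`TV(A_γ^σ, N(0,1/(2π))) = (1/2)∫ exp(-πz²)|T_γ^σ(z) − 1| dz` exceeds `1/2`. -/
theorem smoothedDiscreteGaussian_tv_lower :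
    ∃ C > (0 : ℝ), ∀ γ σ : ℝ, 1 < γ → 0 < σ → γ * σ < C →
      (1 / 2) * ∫ z : ℝ, Real.exp (-Real.pi * z ^ 2) * |pancakeLR γ σ z - 1| > 1 / 2 := by
  refine ⟨1 / 20, by norm_num, fun γ σ hγ hσ hC => ?_⟩
  have hγ0 : 0 < γ := by linarith
  set s := Real.sqrt (1 + σ ^ 2) with hs
  have hs2 : s ^ 2 = 1 + σ ^ 2 := Real.sq_sqrt (by positivity)
  have hP := aux_char γ σ hγ hσ
  rw [← hs] at hP
  have hQ : ∀ j : ℕ, _ := fun j => aux_gauss_cos (j * γ * s)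
  have iP : ∀ j : ℕ, Integrable (fun z : ℝ => Real.exp (-Real.pi * z ^ 2) * pancakeLR γ σ z *
        Real.cos (2 * Real.pi * (j * γ * s) * z)) := by
    intro j
    by_contra hc
    have := hP j
    rw [integral_undef hc] at this
    exact (Real.exp_pos _).ne this
  have iQ : ∀ j : ℕ, Integrable (fun z : ℝ => Real.exp (-Real.pi * z ^ 2) *
        Real.cos (2 * Real.pi * (j * γ * s) * z)) := by
    intro j
    by_contra hc
    have := hQ j
    rw [integral_undef hc] at this
    exact (Real.exp_pos _).ne this
  have hD : ∀ j : ℕ, ∫ z : ℝ, (Real.exp (-Real.pi * z ^ 2) * pancakeLR γ σ z *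
        Real.cos (2 * Real.pi * (j * γ * s) * z) - Real.exp (-Real.pi * z ^ 2) *
        Real.cos (2 * Real.pi * (j * γ * s) * z)) =
      Real.exp (-Real.pi * (j * γ * σ) ^ 2) - Real.exp (-Real.pi * (j * γ * s) ^ 2) := by
    intro j
    rw [integral_sub (iP j) (iQ j), hP, hQ]
  have iD := fun j : ℕ => (iP j).sub (iQ j)
  have iabs : Integrable (fun z : ℝ => Real.exp (-Real.pi * z ^ 2) * |pancakeLR γ σ z - 1|) := by
    have := (iD 0).abs
    refine this.congr (Filter.Eventually.of_forall fun z => ?_)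
    simp only [Pi.sub_apply, Nat.cast_zero, zero_mul, mul_zero, Real.cos_zero, mul_one]
    rw [← abs_of_pos (Real.exp_pos (-Real.pi * z ^ 2)), ← abs_mul,
      abs_of_pos (Real.exp_pos (-Real.pi * z ^ 2)), mul_sub, mul_one]
  have hmono := integral_mono (((iD 1).add ((iD 2).const_mul (1 / 4))).sub
    ((iD 0).const_mul (1 / 4))) iabs (fun z => by
      have h2 : Real.cos (2 * Real.pi * (((2 : ℕ) : ℝ) * γ * s) * z) =
          2 * Real.cos (2 * Real.pi * (((1 : ℕ) : ℝ) * γ * s) * z) ^ 2 - 1 := by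
        rw [← Real.cos_two_mul]; congr 1; push_cast; ring
      simp only [Pi.sub_apply, Pi.add_apply, h2, Nat.cast_zero, zero_mul, mul_zero, Real.cos_zero]
      have hc1 := Real.cos_le_one (2 * Real.pi * (((1 : ℕ) : ℝ) * γ * s) * z)
      have hc2 := Real.neg_one_le_cos (2 * Real.pi * (((1 : ℕ) : ℝ) * γ * s) * z)
      generalize Real.cos (2 * Real.pi * (((1 : ℕ) : ℝ) * γ * s) * z) = c at *
      have hE := Real.exp_pos (-Real.pi * z ^ 2)
      generalize Real.exp (-Real.pi * z ^ 2) = E at *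
      generalize pancakeLR γ σ z = T
      have hf : |(1 + c) ^ 2 / 2 - 1| ≤ 1 := by
        rw [abs_le]; constructor <;> nlinarith
      have h3 : ((1 + c) ^ 2 / 2 - 1) * (T - 1) ≤ |T - 1| := by
        calc _ ≤ |((1 + c) ^ 2 / 2 - 1) * (T - 1)| := le_abs_self _
          _ = |(1 + c) ^ 2 / 2 - 1| * |T - 1| := abs_mul _ _
          _ ≤ 1 * |T - 1| := by gcongr
          _ = _ := one_mul _
      calc _ = E * (((1 + c) ^ 2 / 2 - 1) * (T - 1)) := by ring
        _ ≤ _ := by gcongr)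
  have hval := integral_sub (((iD 1).add ((iD 2).const_mul (1 / 4)))) ((iD 0).const_mul (1 / 4))
  have hval2 := integral_add (iD 1) ((iD 2).const_mul (1 / 4))
  simp only [Pi.sub_apply, Pi.add_apply, integral_const_mul, hD] at hmono hval hval2
  rw [hval, hval2] at hmono
  simp only [Nat.cast_zero, Nat.cast_one, Nat.cast_ofNat, zero_mul, one_mul] at hmono
  have hp3 := Real.pi_gt_three
  have hp4 := Real.pi_lt_d2
  have ha : (γ * σ) ^ 2 ≤ 1 / 400 := by nlinarith [mul_pos hγ0 hσ]
  have b1 := Real.add_one_le_exp (-Real.pi * (γ * σ) ^ 2)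
  have b2 := Real.add_one_le_exp (-Real.pi * (2 * γ * σ) ^ 2)
  have hsg : 1 ≤ (γ * s) ^ 2 := by
    rw [mul_pow, hs2]; nlinarith [sq_nonneg σ, sq_nonneg (γ * σ)]
  have e3 : Real.exp (-3 : ℝ) < 1 / 16 := by
    have : Real.exp (-3 : ℝ) = Real.exp (-1) ^ 3 := by rw [← Real.exp_nat_mul]; norm_num
    rw [this]
    have h1 := Real.exp_neg_one_lt_d9
    have h0 := Real.exp_pos (-1)
    calc Real.exp (-1) ^ 3 ≤ 0.37 ^ 3 := by gcongr; linarith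
      _ < _ := by norm_num
  have c1 : Real.exp (-Real.pi * (γ * s) ^ 2) ≤ Real.exp (-3) := Real.exp_le_exp.2 (by nlinarith)
  have c2 : Real.exp (-Real.pi * (2 * γ * s) ^ 2) ≤ Real.exp (-3) :=
    Real.exp_le_exp.2 (by nlinarith)
  have d : Real.pi * (γ * σ) ^ 2 ≤ 3.15 * (1 / 400) := by gcongr
  rw [show (0 : ℝ) ^ 2 = 0 by norm_num, sub_self, mul_zero, sub_zero] at hmono
  nlinarith
end

section
/- Let T_γ^σ be the likelihood ratio of the σ-smoothed discrete Gaussian A_γ^σ on (1/γ)ℤ with respect to N(0, 1/(2π)). Then for any γ > 1, σ > 0, setting s = σ/√(1+σ²), the logarithmic derivative satisfies the uniform bound |(T_γ^σ)'(z)/T_γ^σ(z)| ≤ 8π/s² for all z ∈ ℝ. -/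
open Real

lemma plr_pt (c b y : ℝ) (hb : 0 < b) (hc : π ≤ c * b ^ 2) :
    |y| * exp (-c * y ^ 2) ≤ b * exp (-c * y ^ 2) + b / 2 * exp (-c * (y - b) ^ 2)
      + b / 2 * exp (-c * (y + b) ^ 2) := by
  have key : ∀ y : ℝ, b ≤ y → y * exp (-c * y ^ 2) ≤ b / 2 * exp (-c * (y - b) ^ 2) := by
    intro y hy
    have e1 : exp (-c * (y - b) ^ 2) = exp (-c * y ^ 2) * exp (c * (2 * y * b - b ^ 2)) := by
      rw [← exp_add]; congr 1; ring
    have h1 := add_one_le_exp (c * (2 * y * b - b ^ 2))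
    have hcp : 0 < c := by
      by_contra h
      have : c * b ^ 2 ≤ 0 := mul_nonpos_of_nonpos_of_nonneg (not_lt.mp h) (by positivity)
      linarith [pi_pos]
    have h2 : y ≤ b / 2 * exp (c * (2 * y * b - b ^ 2)) := by
      have h3 : 3 * y ≤ b * (c * (2 * y * b - b ^ 2)) := by
        have : b * (c * (2 * y * b - b ^ 2)) = (c * b ^ 2) * (2 * y - b) := by ring
        rw [this]
        nlinarith [pi_gt_three]
      nlinarith
    rw [e1]
    nlinarith [exp_pos (-c * y ^ 2)]
  have p0 := exp_pos (-c * y ^ 2)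
  have p1 := exp_pos (-c * (y - b) ^ 2)
  have p2 := exp_pos (-c * (y + b) ^ 2)
  have q0 := mul_pos hb p0
  have q1 := mul_pos hb p1
  have q2 := mul_pos hb p2
  rcases le_or_gt |y| b with h | h
  · have := mul_le_mul_of_nonneg_right h p0.le
    linarith
  · rcases le_total 0 y with hy | hy
    · rw [abs_of_nonneg hy] at h ⊢
      linarith [key y h.le]
    · rw [abs_of_nonpos hy] at h ⊢
      have := key (-y) h.le
      rw [show (-y) ^ 2 = y ^ 2 by ring, show (-y - b) ^ 2 = (y + b) ^ 2 by ring] at this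
      linarith

lemma plr_term_le (a c R x : ℝ) (ha : 0 < a) (hc : 0 < c) (hx : |x| ≤ R) (k : ℤ) :
    exp (-c * (x - a * k) ^ 2)
      ≤ exp (-π * (c * a ^ 2 / π * k ^ 2 - 2 * (c * a * R / π) * |k|)) := by
  apply exp_le_exp.mpr
  have hp := pi_pos
  have e : -π * (c * a ^ 2 / π * k ^ 2 - 2 * (c * a * R / π) * |(k : ℝ)|)
      = -c * (a ^ 2 * k ^ 2 - 2 * a * R * |(k : ℝ)|) := by field_simp
  push_cast
  rw [e]
  have h1 : x * k ≤ R * |(k : ℝ)| := by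
    calc x * k ≤ |x * k| := le_abs_self _
      _ = |x| * |(k : ℝ)| := abs_mul _ _
      _ ≤ _ := by gcongr
  have h2 : a ^ 2 * (k : ℝ) ^ 2 - 2 * a * R * |(k : ℝ)| ≤ (x - a * k) ^ 2 := by
    nlinarith [mul_le_mul_of_nonneg_left h1 ha.le, sq_nonneg x]
  nlinarith [mul_le_mul_of_nonneg_left h2 hc.le]

lemma plr_summable (a c x : ℝ) (ha : 0 < a) (hc : 0 < c) :
    Summable (fun k : ℤ => exp (-c * (x - a * k) ^ 2)) := by
  have hT : 0 < c * a ^ 2 / π := by have := pi_pos; positivity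
  have h := summable_pow_mul_jacobiTheta₂_term_bound (c * a * |x| / π) hT 0
  simp only [pow_zero, one_mul] at h
  exact Summable.of_nonneg_of_le (fun _ => (exp_pos _).le)
    (fun k => plr_term_le a c |x| x ha hc le_rfl k) h

lemma plr_bound_summable (a c R : ℝ) (ha : 0 < a) (hc : 0 < c) :
    Summable (fun k : ℤ => 2 * c * (R + a * |(k : ℝ)|) *
      exp (-π * (c * a ^ 2 / π * k ^ 2 - 2 * (c * a * R / π) * |k|))) := by
  have hT : 0 < c * a ^ 2 / π := by have := pi_pos; positivity
  have h0 := summable_pow_mul_jacobiTheta₂_term_bound (c * a * R / π) hT 0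
  have h1 := summable_pow_mul_jacobiTheta₂_term_bound (c * a * R / π) hT 1
  refine ((h0.mul_left (2 * c * R)).add (h1.mul_left (2 * c * a))).congr ?_
  intro k
  push_cast
  ring

lemma plr_der_le (a c R x : ℝ) (ha : 0 < a) (hc : 0 < c) (hx : |x| ≤ R) (k : ℤ) :
    ‖-2 * c * (x - a * k) * exp (-c * (x - a * k) ^ 2)‖ ≤ 2 * c * (R + a * |(k : ℝ)|) *
      exp (-π * (c * a ^ 2 / π * k ^ 2 - 2 * (c * a * R / π) * |k|)) := by
  rw [norm_mul, norm_mul, norm_of_nonneg (exp_pos _).le]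
  have h1 : ‖x - a * k‖ ≤ R + a * |(k : ℝ)| := by
    calc ‖x - a * k‖ ≤ ‖x‖ + ‖a * k‖ := norm_sub_le _ _
      _ = |x| + a * |(k : ℝ)| := by
        rw [norm_mul, norm_eq_abs, norm_eq_abs, norm_eq_abs, abs_of_pos ha]
      _ ≤ _ := by gcongr
  have h2 : ‖-2 * c‖ = 2 * c := by
    rw [norm_eq_abs, abs_of_neg (by linarith)]; ring
  rw [h2]
  have := plr_term_le a c R x ha hc hx k
  have h3 : 0 ≤ R + a * |(k : ℝ)| := le_trans (norm_nonneg _) h1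
  gcongr

lemma plr_hasDeriv (a c z : ℝ) (ha : 0 < a) (hc : 0 < c) :
    HasDerivAt (fun x => ∑' k : ℤ, exp (-c * (x - a * k) ^ 2))
      (∑' k : ℤ, -2 * c * (z - a * k) * exp (-c * (z - a * k) ^ 2)) z := by
  have hz : z ∈ Metric.ball (0 : ℝ) (|z| + 1) := by simp
  refine hasDerivAt_tsum_of_isPreconnected (plr_bound_summable a c (|z| + 1) ha hc)
    Metric.isOpen_ball (convex_ball _ _).isPreconnected
    (g := fun (k : ℤ) x => exp (-c * (x - a * k) ^ 2))
    (g' := fun (k : ℤ) x => -2 * c * (x - a * k) * exp (-c * (x - a * k) ^ 2))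
    ?_ ?_ hz (plr_summable a c z ha hc) hz
  · intro k y _
    have h := (((hasDerivAt_id y).sub_const (a * k)).pow 2).const_mul (-c) |>.exp
    refine h.congr_deriv ?_
    simp
    ring
  · intro k y hy
    refine plr_der_le a c _ y ha hc ?_ k
    simpa using (mem_ball_zero_iff.mp hy).le

lemma plr_main (a c z : ℝ) (m : ℤ) (ha : 0 < a) (hc : 0 < c) (hm : 0 < m)
    (h : π ≤ c * (a * m) ^ 2) :
    |∑' k : ℤ, -2 * c * (z - a * k) * exp (-c * (z - a * k) ^ 2)|
      ≤ 4 * c * (a * m) * ∑' k : ℤ, exp (-c * (z - a * k) ^ 2) := by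
  have hmr : (0 : ℝ) < m := by exact_mod_cast hm
  set F : ℤ → ℝ := fun k => exp (-c * (z - a * k) ^ 2) with hF
  have hs : Summable F := plr_summable a c z ha hc
  have hs1 : Summable (fun k => F (k + m)) := (Equiv.addRight m).summable_iff.mpr hs
  have hs2 : Summable (fun k => F (k - m)) := (Equiv.subRight m).summable_iff.mpr hs
  have t1 : ∑' k, F (k + m) = ∑' k, F k := (Equiv.addRight m).tsum_eq F
  have t2 : ∑' k, F (k - m) = ∑' k, F k := (Equiv.subRight m).tsum_eq F
  set b := a * m with hb
  have hbp : 0 < b := by positivity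
  have hsum := ((hs.mul_left b).add (hs1.mul_left (b / 2))).add (hs2.mul_left (b / 2))
  have hts : HasSum (fun k => 2 * c * (b * F k + b / 2 * F (k + m) + b / 2 * F (k - m)))
      (4 * c * b * ∑' k, F k) := by
    have := (((hs.hasSum.mul_left b).add (hs1.hasSum.mul_left (b / 2))).add
      (hs2.hasSum.mul_left (b / 2))).mul_left (2 * c)
    rw [t1, t2] at this
    rw [show 4 * c * b * ∑' k, F k = 2 * c * (b * ∑' k, F k + b / 2 * ∑' k, F k
      + b / 2 * ∑' k, F k) by ring]
    exact this
  rw [← norm_eq_abs]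
  refine tsum_of_norm_bounded hts ?_
  intro k
  have h1 := plr_pt c b (z - a * k) hbp h
  rw [norm_mul, norm_mul, norm_of_nonneg (exp_pos _).le, norm_eq_abs, norm_eq_abs,
    show |-2 * c| = 2 * c by rw [abs_of_neg (by linarith)]; ring, mul_assoc]
  refine mul_le_mul_of_nonneg_left ?_ (by positivity)
  have e1 : F (k + m) = exp (-c * (z - a * k - b) ^ 2) := by
    simp only [hF, hb]; push_cast; congr 2; ring
  have e2 : F (k - m) = exp (-c * (z - a * k + b) ^ 2) := by
    simp only [hF, hb]; push_cast; congr 2; ring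
  rw [e1, e2]
  exact h1

/-- Uniform bound on the logarithmic derivative of the likelihood ratio:
for `γ > 1`, `σ > 0`, and `s = σ/√(1+σ²)`, one has `|T'(z)/T(z)| ≤ 8π/s²`. -/
theorem pancakeLR_logDeriv_bound (γ σ : ℝ) (hγ : 1 < γ) (hσ : 0 < σ) (z : ℝ) :
    |deriv (pancakeLR γ σ) z / pancakeLR γ σ z|
      ≤ 8 * Real.pi / (σ / Real.sqrt (1 + σ ^ 2)) ^ 2 := by
  have hp := pi_pos
  set w := Real.sqrt (1 + σ ^ 2) with hw
  have hw2 : w ^ 2 = 1 + σ ^ 2 := Real.sq_sqrt (by positivity)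
  have hw1 : 1 ≤ w := by rw [hw]; exact Real.one_le_sqrt.mpr (by nlinarith)
  have hwp : 0 < w := by linarith
  have hγp : 0 < γ := by linarith
  set a := w / γ with ha
  set c := π / σ ^ 2 with hc
  have hap : 0 < a := by positivity
  have hcp : 0 < c := by positivity
  set K := w / (σ * latticeMass γ) with hK
  have hfun : pancakeLR γ σ = fun x => K * ∑' k : ℤ, exp (-c * (x - a * k) ^ 2) := by
    funext x
    unfold pancakeLR
    rw [← hw, ← hK]
    congr 1
    refine tsum_congr fun k => ?_
    congr 1
    rw [ha, hc]
    field_simp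
  have hd := (plr_hasDeriv a c z hap hcp).const_mul K
  rw [hfun, hd.deriv]
  set m : ℤ := ⌈γ⌉ with hm
  have hm1 : γ ≤ m := Int.le_ceil γ
  have hm2 : (m : ℝ) ≤ 2 * γ := by have := Int.ceil_lt_add_one γ; linarith
  have hmp : 0 < m := Int.ceil_pos.mpr hγp
  have hb1 : w ≤ a * m := by
    rw [ha, div_mul_eq_mul_div, le_div_iff₀ hγp]; gcongr
  have hb2 : a * m ≤ 2 * w := by
    rw [ha, div_mul_eq_mul_div, div_le_iff₀ hγp]; nlinarith
  have hcond : π ≤ c * (a * m) ^ 2 := by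
    rw [hc, div_mul_eq_mul_div, le_div_iff₀ (by positivity)]
    have : σ ^ 2 ≤ (a * m) ^ 2 := by nlinarith
    gcongr
  have hmain := plr_main a c z m hap hcp hmp hcond
  have hS : 0 < ∑' k : ℤ, exp (-c * (z - a * k) ^ 2) :=
    (plr_summable a c z hap hcp).tsum_pos (fun _ => (exp_pos _).le) 0 (exp_pos _)
  have hR : 8 * π / (σ / w) ^ 2 = 8 * c * w ^ 2 := by rw [hc]; field_simp
  rw [hR]
  rcases eq_or_ne K 0 with h0 | h0
  · rw [h0]; simp; positivity
  · rw [mul_div_mul_left _ _ h0, abs_div, abs_of_pos hS, div_le_iff₀ hS]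
    refine hmain.trans ?_
    refine mul_le_mul_of_nonneg_right ?_ hS.le
    have : a * m ≤ 2 * w ^ 2 := by nlinarith
    nlinarith
end

section
/- Monotonicity of the smoothed likelihood-ratio overlap: fix γ > 0 and β > 0. Define G(σ) = E_{x ∼ A_γ^σ}[T_γ^β(x)] = ⟨T_γ^β, T_γ^σ⟩_Q. Then G(σ) = Σ_{k≥0} α_{2k}² / ((1+β²)^k (1+σ²)^k), where α_{2k} are the Hermite coefficients of T_γ^0, and G is strictly decreasing on (0,∞) provided some α_{2k} with k ≥ 1 is nonzero. -/
open Real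

/-- Hermite polynomials normalized to be orthonormal with respect to `N(0, 1/(2π))`. -/
noncomputable def hermiteQ (n : ℕ) (x : ℝ) : ℝ :=
  ((Polynomial.hermite n).map (Int.castRingHom ℝ)).eval (Real.sqrt (2 * Real.pi) * x) / Real.sqrt (n.factorial)

/-- Hermite coefficients of the (unsmoothed) discrete Gaussian `A_γ`:
`α_{2k} = E_{x∼A_γ}[h_{2k}(x)]`. -/
noncomputable def hermiteCoeff (γ : ℝ) (k : ℕ) : ℝ :=
  ∑' j : ℤ, (Real.exp (-Real.pi * ((j : ℝ) / γ) ^ 2) / latticeMass γ) *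
    hermiteQ (2 * k) ((j : ℝ) / γ)


/-- Real Hermite function. -/
noncomputable def hermR (n : ℕ) (x : ℝ) : ℝ :=
  ((Polynomial.hermite n).map (Int.castRingHom ℝ)).eval x

lemma derivative_hermite_succ_aux (n : ℕ) :
    Polynomial.derivative (Polynomial.hermite (n + 1)) =
      ((n : Polynomial ℤ) + 1) * Polynomial.hermite n := by
  induction n with
  | zero => simp
  | succ n ih =>
    rw [Polynomial.hermite_succ (n + 1)]
    simp only [Polynomial.derivative_sub, Polynomial.derivative_mul, Polynomial.derivative_X]
    rw [ih]
    simp only [Polynomial.derivative_mul, Polynomial.derivative_add, Polynomial.derivative_natCast,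
      Polynomial.derivative_one]
    rw [Polynomial.hermite_succ n]
    push_cast
    ring

lemma hermR_zero (x : ℝ) : hermR 0 x = 1 := by simp [hermR]
lemma hermR_one (x : ℝ) : hermR 1 x = x := by simp [hermR]

lemma hermR_rec (n : ℕ) (x : ℝ) :
    hermR (n + 2) x = x * hermR (n + 1) x - (n + 1) * hermR n x := by
  unfold hermR
  rw [Polynomial.hermite_succ (n + 1), derivative_hermite_succ_aux]
  simp

lemma hermR_neg (n : ℕ) (x : ℝ) : hermR n (-x) = (-1) ^ n * hermR n x := by
  induction n using Nat.twoStepInduction with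
  | zero => simp [hermR_zero]
  | one => simp [hermR_one]
  | more n ih1 ih2 => rw [hermR_rec, hermR_rec, ih1, ih2]; ring

open MeasureTheory Complex in
lemma integrable_moment (x : ℝ) (n : ℕ) :
    Integrable (fun z : ℝ => ((x : ℂ) + I * z) ^ n * (Real.exp (-z ^ 2 / 2) : ℂ)) := by
  have hg := ((integrable_exp_neg_mul_sq (b := 1 / 4) (by norm_num)).const_mul
    (n.factorial * Real.exp (|x| + 1)))
  refine hg.mono' (by fun_prop) (Filter.Eventually.of_forall fun z => ?_)
  rw [norm_mul, norm_pow, Complex.norm_real, Real.norm_of_nonneg (Real.exp_pos _).le]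
  have h1 : ‖(x : ℂ) + I * z‖ ≤ |x| + 1 + z ^ 2 / 4 := by
    refine (norm_add_le _ _).trans ?_
    simp only [norm_mul, norm_I, one_mul, Complex.norm_real, Real.norm_eq_abs]
    nlinarith [sq_nonneg (|z| - 2), sq_abs z]
  have h2 := Real.pow_div_factorial_le_exp _ (norm_nonneg ((x : ℂ) + I * z)) n
  rw [div_le_iff₀ (by positivity)] at h2
  have h3 := Real.exp_le_exp.2 h1
  have h4 : Real.exp (-(1 / 4) * z ^ 2) = Real.exp (z ^ 2 / 4) * Real.exp (-z ^ 2 / 2) := by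
    rw [← Real.exp_add]; ring_nf
  rw [Real.exp_add] at h3
  rw [h4]
  calc _ ≤ (Real.exp (|x| + 1) * Real.exp (z ^ 2 / 4) * n.factorial) * Real.exp (-z ^ 2 / 2) := by
        gcongr; exact h2.trans (by gcongr)
    _ = _ := by ring

open MeasureTheory Complex in
lemma moment_rec (x : ℝ) (n : ℕ) :
    ∫ z : ℝ, ((x : ℂ) + I * z) ^ (n + 2) * (Real.exp (-z ^ 2 / 2) : ℂ) =
      x * (∫ z : ℝ, ((x : ℂ) + I * z) ^ (n + 1) * (Real.exp (-z ^ 2 / 2) : ℂ))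
      - (n + 1) * (∫ z : ℝ, ((x : ℂ) + I * z) ^ n * (Real.exp (-z ^ 2 / 2) : ℂ)) := by
  have hi := integrable_moment x
  have i0 : Integrable (fun z : ℝ => I * ((n + 1) * (((x : ℂ) + I * z) ^ n * (Real.exp (-z ^ 2 / 2) : ℂ)))) :=
    ((hi n).const_mul _).const_mul _
  have i1 : Integrable (fun z : ℝ => I * (((x : ℂ) + I * z) ^ (n + 2) * (Real.exp (-z ^ 2 / 2) : ℂ))) :=
    (hi (n + 2)).const_mul _
  have i2 : Integrable (fun z : ℝ => I * (x * (((x : ℂ) + I * z) ^ (n + 1) * (Real.exp (-z ^ 2 / 2) : ℂ)))) :=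
    ((hi (n + 1)).const_mul _).const_mul _
  have i3 : Integrable (fun z : ℝ => I * (((x : ℂ) + I * z) ^ (n + 2) * (Real.exp (-z ^ 2 / 2) : ℂ))
     - I * (x * (((x : ℂ) + I * z) ^ (n + 1) * (Real.exp (-z ^ 2 / 2) : ℂ)))) := i1.sub i2
  have hInteg : Integrable (fun z : ℝ => I * ((n + 1) * (((x : ℂ) + I * z) ^ n * (Real.exp (-z ^ 2 / 2) : ℂ)))
      + (I * (((x : ℂ) + I * z) ^ (n + 2) * (Real.exp (-z ^ 2 / 2) : ℂ))
      - I * (x * (((x : ℂ) + I * z) ^ (n + 1) * (Real.exp (-z ^ 2 / 2) : ℂ))))) :=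
    i0.add i3
  have hz := integral_eq_zero_of_hasDerivAt_of_integrable (f := fun z : ℝ =>
    ((x : ℂ) + I * z) ^ (n + 1) * (Real.exp (-z ^ 2 / 2) : ℂ)) (f' := _) ?_ hInteg (hi (n + 1))
  · rw [integral_add i0 i3, integral_sub i1 i2] at hz
    simp only [integral_const_mul] at hz
    have : I * I = -1 := I_mul_I
    apply mul_left_cancel₀ I_ne_zero
    linear_combination hz
  · intro z
    have h1 : HasDerivAt (fun z : ℝ => (x : ℂ) + I * z) (I * 1) z :=
      ((Complex.ofRealCLM.hasDerivAt (x := z)).const_mul I).const_add (x : ℂ)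
    have h2 : HasDerivAt (fun z : ℝ => ((Real.exp (-z ^ 2 / 2) : ℝ) : ℂ))
        ((Real.exp (-z ^ 2 / 2) * (-(2 * z) / 2) : ℝ) : ℂ) z := by
      apply HasDerivAt.ofReal_comp
      have : HasDerivAt (fun z : ℝ => -z ^ 2 / 2) (-(2 * z) / 2) z := by
        have := ((hasDerivAt_pow 2 z).neg).div_const 2
        simpa using this
      exact this.exp
    have h3 := (h1.pow (n + 1)).mul h2
    refine h3.congr_deriv ?_
    push_cast
    simp only [Pi.pow_apply]
    have : I * I = -1 := I_mul_I
    linear_combination (-(z:ℂ) * (x + I * z) ^ (n + 1) * cexp (-(z:ℂ) ^ 2 / 2)) * this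

open MeasureTheory Complex in
lemma moment_eq (x : ℝ) (n : ℕ) :
    ∫ z : ℝ, ((x : ℂ) + I * z) ^ n * (Real.exp (-z ^ 2 / 2) : ℂ) =
      ((√(2 * π) * hermR n x : ℝ) : ℂ) := by
  have h0 : ∫ z : ℝ, (Real.exp (-z ^ 2 / 2) : ℂ) = ((√(2 * π) : ℝ) : ℂ) := by
    rw [integral_complex_ofReal]
    congr 1
    have := integral_gaussian (1 / 2)
    rw [show π / (1 / 2) = 2 * π by ring] at this
    rw [← this]
    congr 1; ext z; ring_nf
  induction n using Nat.twoStepInduction with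
  | zero => simpa [hermR_zero] using h0
  | one =>
    have hz : ∫ z : ℝ, (z : ℂ) * (Real.exp (-z ^ 2 / 2) : ℂ) = 0 := by
      have h := integral_neg_eq_self (fun z : ℝ => (z : ℂ) * (Real.exp (-z ^ 2 / 2) : ℂ)) volume
      simp only [ofReal_neg, neg_mul, even_two, Even.neg_pow, integral_neg] at h
      have h2 : (2 : ℂ) * ∫ z : ℝ, (z : ℂ) * (Real.exp (-z ^ 2 / 2) : ℂ) = 0 := by
        linear_combination -h
      simpa using h2
    have h1 := integrable_moment x 1
    have hi0 : Integrable (fun z : ℝ => (x : ℂ) * (Real.exp (-z ^ 2 / 2) : ℂ)) := by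
      have := (integrable_moment x 0).const_mul (x : ℂ)
      simpa using this
    have hi1 : Integrable (fun z : ℝ => I * ((z : ℂ) * (Real.exp (-z ^ 2 / 2) : ℂ))) := by
      refine (h1.sub hi0).congr (Filter.Eventually.of_forall fun z => ?_)
      simp only [Pi.sub_apply]; ring
    have : ∀ z : ℝ, ((x : ℂ) + I * z) ^ 1 * (Real.exp (-z ^ 2 / 2) : ℂ) =
       (x : ℂ) * (Real.exp (-z ^ 2 / 2) : ℂ) + I * ((z : ℂ) * (Real.exp (-z ^ 2 / 2) : ℂ)) := by
      intro z; ring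
    simp_rw [this]
    rw [integral_add hi0 hi1, integral_const_mul, integral_const_mul, hz, h0, hermR_one]
    push_cast; ring
  | more n ih1 ih2 =>
    rw [moment_rec, ih1, ih2, hermR_rec]
    push_cast; ring

open MeasureTheory Complex in
lemma cgauss (b : ℝ) (hb : 0 < b) (c d : ℂ) :
    ∫ x : ℝ, cexp (-(b : ℂ) * x ^ 2 + c * x + d) =
      ((√(π / b) : ℝ) : ℂ) * cexp (d + c ^ 2 / (4 * b)) := by
  rw [integral_cexp_quadratic (by simpa using hb)]
  congr 1
  · rw [Real.sqrt_eq_rpow, Complex.ofReal_cpow (by positivity)]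
    push_cast; simp
  · congr 1
    have : (b : ℂ) ≠ 0 := by exact_mod_cast hb.ne'
    field_simp
    ring

open MeasureTheory in
lemma rgauss (b : ℝ) (hb : 0 < b) (c d : ℝ) :
    ∫ x : ℝ, rexp (-b * x ^ 2 + c * x + d) = √(π / b) * rexp (d + c ^ 2 / (4 * b)) := by
  have h := cgauss b hb c d
  have : ∀ x : ℝ, Complex.exp (-(b : ℂ) * x ^ 2 + c * x + d) =
      ((rexp (-b * x ^ 2 + c * x + d) : ℝ) : ℂ) := by intro x; push_cast; rfl
  simp_rw [this] at h
  rw [integral_complex_ofReal] at h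
  exact_mod_cast h

open MeasureTheory in
lemma rgauss_int (b : ℝ) (hb : 0 < b) (c d : ℝ) :
    Integrable (fun x : ℝ => rexp (-b * x ^ 2 + c * x + d)) := by
  by_contra H
  have := rgauss b hb c d
  rw [integral_undef H] at this
  have : 0 < √(π / b) * rexp (d + c ^ 2 / (4 * b)) := by positivity
  linarith

noncomputable def mehlerK (ρ x y : ℝ) : ℝ :=
  (√(1 - ρ ^ 2))⁻¹ * rexp (-(ρ ^ 2 * (x ^ 2 + y ^ 2) - 2 * ρ * x * y) / (2 * (1 - ρ ^ 2)))

open MeasureTheory Complex in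
lemma mehler (ρ : ℝ) (h0 : 0 < ρ) (h1 : ρ < 1) (x y : ℝ) :
    HasSum (fun n : ℕ => ρ ^ n / n.factorial * hermR n x * hermR n y) (mehlerK ρ x y) := by
  set E : ℝ → ℂ := fun z => (Real.exp (-z ^ 2 / 2) : ℂ) with hE
  set F : ℕ → ℝ × ℝ → ℂ := fun n p =>
    (ρ ^ n / n.factorial : ℂ) * ((((x : ℂ) + I * p.1) ^ n * E p.1) * (((y : ℂ) + I * p.2) ^ n * E p.2)) with hF
  set f : ℝ × ℝ → ℂ := fun p =>
    cexp (ρ * ((x : ℂ) + I * p.1) * ((y : ℂ) + I * p.2)) * (E p.1 * E p.2) with hf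
  set bd : ℕ → ℝ × ℝ → ℝ := fun n p =>
    (ρ * ‖(x : ℂ) + I * p.1‖ * ‖(y : ℂ) + I * p.2‖) ^ n / n.factorial * (Real.exp (-p.1 ^ 2 / 2) * Real.exp (-p.2 ^ 2 / 2)) with hbd
  have hEn : ∀ z, ‖E z‖ = Real.exp (-z ^ 2 / 2) := fun z => by
    simp only [hE, Complex.norm_real, Real.norm_of_nonneg (Real.exp_pos _).le]
  have hFbd : ∀ n p, ‖F n p‖ = bd n p := by
    intro n p
    simp only [hF, hbd, norm_mul, norm_div, norm_pow, hEn, Complex.norm_real, Real.norm_of_nonneg h0.le,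
      Complex.norm_natCast]
    ring
  have hbs : ∀ p, HasSum (fun n => bd n p)
      (Real.exp (ρ * ‖(x : ℂ) + I * p.1‖ * ‖(y : ℂ) + I * p.2‖) * (Real.exp (-p.1 ^ 2 / 2) * Real.exp (-p.2 ^ 2 / 2))) := by
    intro p
    have := NormedSpace.expSeries_div_hasSum_exp (ρ * ‖(x : ℂ) + I * p.1‖ * ‖(y : ℂ) + I * p.2‖)
    rw [← Real.exp_eq_exp_ℝ] at this
    exact this.mul_right _
  have hFs : ∀ p, HasSum (fun n => F n p) (f p) := by
    intro p
    have := NormedSpace.expSeries_div_hasSum_exp (ρ * ((x : ℂ) + I * p.1) * ((y : ℂ) + I * p.2))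
    rw [← Complex.exp_eq_exp_ℂ] at this
    have := this.mul_right (E p.1 * E p.2)
    refine this.congr_fun ?_
    intro n
    simp only [hF, mul_pow]
    ring
  have hn2 : ∀ u v : ℝ, ‖(u : ℂ) + I * v‖ ^ 2 = u ^ 2 + v ^ 2 := by
    intro u v
    rw [← Complex.normSq_eq_norm_sq, mul_comm, Complex.normSq_add_mul_I]
  have hbint : Integrable (fun p : ℝ × ℝ => Real.exp (ρ * ‖(x : ℂ) + I * p.1‖ * ‖(y : ℂ) + I * p.2‖) * (Real.exp (-p.1 ^ 2 / 2) * Real.exp (-p.2 ^ 2 / 2))) := by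
    have hg := (integrable_exp_neg_mul_sq (b := (1 - ρ) / 2) (by linarith))
    have hg2 := (hg.mul_prod hg).const_mul (Real.exp (ρ * (x ^ 2 + y ^ 2) / 2))
    refine hg2.mono' (by fun_prop) (Filter.Eventually.of_forall fun p => ?_)
    rw [Real.norm_of_nonneg (by positivity), ← Real.exp_add, ← Real.exp_add, ← Real.exp_add,
      ← Real.exp_add, Real.exp_le_exp]
    have := mul_nonneg h0.le (sq_nonneg (‖(x : ℂ) + I * p.1‖ - ‖(y : ℂ) + I * p.2‖))
    rw [sub_sq, hn2, hn2] at this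
    linarith
  have hfint : Integrable f := by
    refine hbint.mono' (by simp only [hf, hE]; fun_prop) (Filter.Eventually.of_forall fun p => ?_)
    rw [← (hbs p).tsum_eq, ← (hFs p).tsum_eq]
    have hs : Summable (fun n => ‖F n p‖) := by
      simp_rw [hFbd]; exact (hbs p).summable
    refine (norm_tsum_le_tsum_norm hs).trans (le_of_eq ?_)
    simp_rw [hFbd]
  have key := hasSum_integral_of_dominated_convergence (μ := (volume : Measure (ℝ × ℝ))) (F := F) (f := f) bd
    (fun n => by simp only [hF, hE]; fun_prop)
    (fun n => Filter.Eventually.of_forall fun p => (hFbd n p).le)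
    (Filter.Eventually.of_forall fun p => (hbs p).summable)
    (by simp_rw [fun p => (hbs p).tsum_eq]; exact hbint)
    (Filter.Eventually.of_forall hFs)
  have hFi : ∀ n, ∫ p, F n p = ((2 * π * (ρ ^ n / n.factorial * hermR n x * hermR n y) : ℝ) : ℂ) := by
    intro n
    simp only [hF]
    rw [integral_const_mul, Measure.volume_eq_prod,
      integral_prod_mul (fun z : ℝ => ((x : ℂ) + I * z) ^ n * E z) (fun z : ℝ => ((y : ℂ) + I * z) ^ n * E z)]
    rw [moment_eq, moment_eq]
    have : (√(2 * π)) * √(2 * π) = 2 * π := Real.mul_self_sqrt (by positivity)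
    generalize √(2 * π) = s at this ⊢
    rw [← this]
    push_cast; ring
  have hρ2 : 0 < 1 - ρ ^ 2 := by nlinarith
  have hfi : ∫ p, f p = ((2 * π * mehlerK ρ x y : ℝ) : ℂ) := by
    rw [Measure.volume_eq_prod, integral_prod _ hfint]
    have e1 : ∀ z : ℝ, ∫ w : ℝ, f (z, w) = ((√(2 * π) : ℝ) : ℂ) *
        cexp (-(((1 - ρ ^ 2) / 2 : ℝ) : ℂ) * z ^ 2 + (I * ρ * (y - ρ * x)) * z + (ρ * x * y - ρ ^ 2 * x ^ 2 / 2)) := by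
      intro z
      have := cgauss (1 / 2) (by norm_num) (I * ρ * (x + I * z)) (ρ * (x + I * z) * y - z ^ 2 / 2)
      rw [show π / (1 / 2) = 2 * π by ring] at this
      convert this using 2
      · ext w
        simp only [hf, hE, Complex.ofReal_exp]
        rw [← Complex.exp_add, ← Complex.exp_add]
        congr 1
        push_cast
        ring
      · congr 1
        push_cast
        have hI : I ^ 2 = -1 := I_sq
        have hI3 : I ^ 3 = -I := by rw [pow_succ, hI]; ring
        have hI4 : I ^ 4 = 1 := I_pow_four
        ring_nf
        simp only [hI, hI3, hI4]
        ring
    simp_rw [e1]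
    rw [integral_const_mul, cgauss _ (by linarith)]
    rw [mehlerK]
    have e2 : √(π / ((1 - ρ ^ 2) / 2)) = √(2 * π) * (√(1 - ρ ^ 2))⁻¹ := by
      rw [← Real.sqrt_inv, ← Real.sqrt_mul (by positivity)]
      congr 1; field_simp
    have e3 : (ρ * x * y - ρ ^ 2 * x ^ 2 / 2 : ℂ) + (I * ρ * (y - ρ * x)) ^ 2 / (4 * (((1 - ρ ^ 2) / 2 : ℝ) : ℂ))
        = ((-(ρ ^ 2 * (x ^ 2 + y ^ 2) - 2 * ρ * x * y) / (2 * (1 - ρ ^ 2)) : ℝ) : ℂ) := by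
      have : ((1 : ℂ) - ρ ^ 2) ≠ 0 := by exact_mod_cast hρ2.ne'
      push_cast
      rw [mul_pow, mul_pow, I_sq]
      field_simp
      ring
    rw [e2, e3, ← Complex.ofReal_exp, ← Complex.ofReal_mul, ← Complex.ofReal_mul]
    congr 1
    have : (√(2 * π)) * √(2 * π) = 2 * π := Real.mul_self_sqrt (by positivity)
    generalize √(2 * π) = s at this ⊢
    rw [← this]
    ring
  simp_rw [hFi] at key
  rw [hfi] at key
  have key2 : HasSum (fun n : ℕ => 2 * π * (ρ ^ n / n.factorial * hermR n x * hermR n y)) (2 * π * mehlerK ρ x y) := by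
    exact_mod_cast key
  exact (hasSum_mul_left_iff (by positivity)).1 key2

lemma mehler_double (ρ : ℝ) (h0 : 0 < ρ) (h1 : ρ < 1) (w x : ℤ → ℝ) (hw : ∀ j, 0 ≤ w j)
    (hws : Summable w) (hK : Summable fun j => w j * mehlerK ρ (x j) (x j)) :
    (Summable fun p : ℤ × ℤ => w p.1 * w p.2 * mehlerK ρ (x p.1) (x p.2)) ∧
    HasSum (fun n : ℕ => ρ ^ n / n.factorial * (∑' j, w j * hermR n (x j)) ^ 2)
      (∑' p : ℤ × ℤ, w p.1 * w p.2 * mehlerK ρ (x p.1) (x p.2)) := by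
  set g : (ℤ × ℤ) × ℕ → ℝ := fun q =>
    w q.1.1 * w q.1.2 * (ρ ^ q.2 / q.2.factorial * hermR q.2 (x q.1.1) * hermR q.2 (x q.1.2)) with hg
  set b : (ℤ × ℤ) × ℕ → ℝ := fun q =>
    w q.1.1 * w q.1.2 * ((ρ ^ q.2 / q.2.factorial * hermR q.2 (x q.1.1) * hermR q.2 (x q.1.1)
      + ρ ^ q.2 / q.2.factorial * hermR q.2 (x q.1.2) * hermR q.2 (x q.1.2)) / 2) with hb
  have hbn : 0 ≤ b := by
    intro q
    simp only [hb, Pi.zero_apply, mul_assoc]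
    have := hw q.1.1
    have := hw q.1.2
    have := mul_self_nonneg (hermR q.2 (x q.1.1))
    have := mul_self_nonneg (hermR q.2 (x q.1.2))
    positivity
  have hbi : ∀ p : ℤ × ℤ, HasSum (fun n => b (p, n))
      (w p.1 * w p.2 * ((mehlerK ρ (x p.1) (x p.1) + mehlerK ρ (x p.2) (x p.2)) / 2)) := fun p =>
    (((mehler ρ h0 h1 (x p.1) (x p.1)).add (mehler ρ h0 h1 (x p.2) (x p.2))).div_const 2).mul_left _
  have hKn : ∀ u v, 0 ≤ mehlerK ρ u v := fun u v => by unfold mehlerK; positivity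
  have hbs : Summable b := by
    rw [summable_prod_of_nonneg hbn]
    refine ⟨fun p => (hbi p).summable, ?_⟩
    simp_rw [fun p => (hbi p).tsum_eq]
    have s1 := hK.mul_of_nonneg hws (fun j => mul_nonneg (hw j) (hKn _ _)) hw
    have s2 := hws.mul_of_nonneg hK hw (fun j => mul_nonneg (hw j) (hKn _ _))
    refine ((s1.add s2).div_const 2).congr fun p => ?_
    ring
  have hgs : Summable g := by
    refine Summable.of_norm_bounded hbs fun q => ?_
    have e : ‖g q‖ = w q.1.1 * w q.1.2 * (ρ ^ q.2 / q.2.factorial) *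
        (|hermR q.2 (x q.1.1)| * |hermR q.2 (x q.1.2)|) := by
      simp only [hg, norm_mul, Real.norm_eq_abs, abs_of_nonneg (hw _)]
      rw [abs_of_nonneg (by positivity : 0 ≤ ρ ^ q.2 / (q.2.factorial : ℝ))]
      ring
    rw [e]
    have e2 : b q = w q.1.1 * w q.1.2 * (ρ ^ q.2 / q.2.factorial) *
        ((|hermR q.2 (x q.1.1)| ^ 2 + |hermR q.2 (x q.1.2)| ^ 2) / 2) := by
      simp only [hb, sq_abs]; ring
    rw [e2]
    have := hw q.1.1
    have := hw q.1.2
    gcongr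
    nlinarith [sq_nonneg (|hermR q.2 (x q.1.1)| - |hermR q.2 (x q.1.2)|)]
  have hgi : ∀ p : ℤ × ℤ, HasSum (fun n => g (p, n)) (w p.1 * w p.2 * mehlerK ρ (x p.1) (x p.2)) :=
    fun p => (mehler ρ h0 h1 (x p.1) (x p.2)).mul_left _
  have hA := hgs.hasSum.prod_fiberwise hgi
  refine ⟨hA.summable, ?_⟩
  rw [hA.tsum_eq]
  have hswap : HasSum (fun q : ℕ × (ℤ × ℤ) => g (q.2, q.1)) (∑' q, g q) :=
    (Equiv.prodComm ℕ (ℤ × ℤ)).hasSum_iff.2 hgs.hasSum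
  refine hswap.prod_fiberwise fun n => ?_
  have hc : 0 < ρ ^ n / (n.factorial : ℝ) := by positivity
  have hsq : Summable fun j => w j * hermR n (x j) ^ 2 := by
    refine Summable.of_nonneg_of_le (fun j => mul_nonneg (hw j) (sq_nonneg _)) (fun j => ?_)
      (hK.mul_left (ρ ^ n / (n.factorial : ℝ))⁻¹)
    have := le_hasSum (mehler ρ h0 h1 (x j) (x j)) n (fun m _ => by
      rw [mul_assoc]
      have := mul_self_nonneg (hermR m (x j))
      positivity)
    rw [inv_mul_eq_div, le_div_iff₀ hc]
    calc _ = w j * (ρ ^ n / n.factorial * hermR n (x j) * hermR n (x j)) := by ring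
      _ ≤ _ := mul_le_mul_of_nonneg_left this (hw j)
  have hs1 : Summable fun j => ‖w j * hermR n (x j)‖ := by
    refine Summable.of_nonneg_of_le (fun j => norm_nonneg _) (fun j => ?_) (hws.add hsq)
    rw [norm_mul, Real.norm_of_nonneg (hw j), Real.norm_eq_abs, ← sq_abs]
    nlinarith [hw j, mul_nonneg (hw j) (sq_nonneg (|hermR n (x j)| - 1)),
      mul_nonneg (hw j) (sq_nonneg (|hermR n (x j)|))]
  have hp := (summable_mul_of_summable_norm hs1 hs1).hasSum.mul_left (ρ ^ n / (n.factorial : ℝ))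
  rw [← tsum_mul_tsum_of_summable_norm hs1 hs1, ← sq] at hp
  refine hp.congr_fun fun p => ?_
  simp only [hg]; ring

lemma summable_gauss_int (c : ℝ) (hc : 0 < c) : Summable fun k : ℤ => rexp (-c * (k : ℝ) ^ 2) := by
  have h : Summable fun n : ℕ => rexp (-c * (n : ℝ) ^ 2) := by
    refine Summable.of_nonneg_of_le (fun _ => (exp_pos _).le) (fun n => ?_)
      (Real.summable_exp_nat_mul_iff.2 (neg_lt_zero.2 hc))
    rw [Real.exp_le_exp]
    have : (n : ℝ) ≤ (n : ℝ) ^ 2 := by exact_mod_cast Nat.le_self_pow two_ne_zero n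
    nlinarith
  refine Summable.of_nat_of_neg (by simpa using h) (by simpa using h)

lemma summable_gauss_shift (c z a : ℝ) (hc : 0 < c) (ha : 0 < a) :
    Summable fun k : ℤ => rexp (-c * (z - a * k) ^ 2) := by
  refine Summable.of_nonneg_of_le (fun _ => (exp_pos _).le) (fun k => ?_)
    ((summable_gauss_int (c * a ^ 2 / 2) (by positivity)).mul_left (rexp (c * z ^ 2)))
  rw [← Real.exp_add, Real.exp_le_exp]
  nlinarith [mul_nonneg hc.le (sq_nonneg (2 * z - a * k))]

lemma latticeMass_pos (γ : ℝ) (hγ : 0 < γ) : 0 < latticeMass γ := by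
  have : Summable fun k : ℤ => rexp (-π * ((k : ℝ) / γ) ^ 2) := by
    refine (summable_gauss_int (π / γ ^ 2) (by positivity)).congr fun k => ?_
    congr 1; field_simp
  exact this.tsum_pos (fun _ => (exp_pos _).le) 0 (exp_pos _)

/-- Normalised weights of the discrete Gaussian. -/
noncomputable def wt (γ : ℝ) (j : ℤ) : ℝ := rexp (-π * ((j : ℝ) / γ) ^ 2) / latticeMass γ

lemma summable_wt (γ : ℝ) (hγ : 0 < γ) : Summable (wt γ) := by
  refine ((summable_gauss_int (π / γ ^ 2) (by positivity)).div_const (latticeMass γ)).congr fun k => ?_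
  unfold wt
  congr 2; field_simp

lemma summable_wtK (γ : ℝ) (hγ : 0 < γ) (ρ : ℝ) (h0 : 0 < ρ) (h1 : ρ < 1) :
    Summable fun j : ℤ => wt γ j * mehlerK ρ (√(2 * π) * (j / γ)) (√(2 * π) * (j / γ)) := by
  have hc : 0 < π / γ ^ 2 * ((1 - ρ) / (1 + ρ)) := by
    have : 0 < 1 - ρ := by linarith
    positivity
  refine ((summable_gauss_int _ hc).mul_left ((√(1 - ρ ^ 2))⁻¹ / latticeMass γ)).congr fun k => ?_
  have h2 : 1 - ρ ≠ 0 := by linarith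
  have h3 : 1 + ρ ≠ 0 := by linarith
  have h4 : 1 - ρ ^ 2 ≠ 0 := by
    rw [show 1 - ρ ^ 2 = (1 - ρ) * (1 + ρ) by ring]; exact mul_ne_zero h2 h3
  have hs : √(2 * π) ^ 2 = 2 * π := Real.sq_sqrt (by positivity)
  unfold wt mehlerK
  rw [show ∀ a b c d : ℝ, a / b * (c * d) = c / b * (a * d) by intros; ring, ← Real.exp_add]
  congr 2
  rw [mul_pow, hs, show 2 * ρ * (√(2 * π) * (k / γ)) * (√(2 * π) * (k / γ)) =
    2 * ρ * √(2 * π) ^ 2 * (k / γ) ^ 2 by ring, hs]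
  rw [show 1 - ρ ^ 2 = (1 - ρ) * (1 + ρ) by ring]
  field_simp
  ring

/-- A single integrand term. -/
noncomputable def termF (M β σ a b x : ℝ) : ℝ :=
  rexp (-π * x ^ 2) *
    (√(1 + β ^ 2) / (β * M) * rexp (-π * (x - √(1 + β ^ 2) * a) ^ 2 / β ^ 2)) *
    (√(1 + σ ^ 2) / (σ * M) * rexp (-π * (x - √(1 + σ ^ 2) * b) ^ 2 / σ ^ 2))

lemma termF_eq (M β σ a b x : ℝ) (hβ : 0 < β) (hσ : 0 < σ) :
    termF M β σ a b x = (√(1 + β ^ 2) / (β * M)) * (√(1 + σ ^ 2) / (σ * M)) *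
      rexp (-(π * (1 + 1 / β ^ 2 + 1 / σ ^ 2)) * x ^ 2 +
        (2 * π * (√(1 + β ^ 2) * a / β ^ 2 + √(1 + σ ^ 2) * b / σ ^ 2)) * x +
        (-π * ((1 + β ^ 2) * a ^ 2 / β ^ 2 + (1 + σ ^ 2) * b ^ 2 / σ ^ 2))) := by
  have hp : √(1 + β ^ 2) ^ 2 = 1 + β ^ 2 := Real.sq_sqrt (by positivity)
  have hq : √(1 + σ ^ 2) ^ 2 = 1 + σ ^ 2 := Real.sq_sqrt (by positivity)
  unfold termF
  rw [← hp, ← hq, Real.sqrt_sq (by positivity), Real.sqrt_sq (by positivity)]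
  generalize √(1 + β ^ 2) = p
  generalize √(1 + σ ^ 2) = q
  rw [show ∀ A B C D E : ℝ, A * (B * C) * (D * E) = B * D * (A * C * E) by intros; ring,
    ← Real.exp_add, ← Real.exp_add]
  congr 2
  field_simp
  ring

open MeasureTheory in
lemma termF_integrable (M β σ a b : ℝ) (hβ : 0 < β) (hσ : 0 < σ) :
    Integrable (termF M β σ a b) := by
  have : termF M β σ a b = _ := funext fun x => termF_eq M β σ a b x hβ hσ
  rw [this]
  exact (rgauss_int _ (by positivity) _ _).const_mul _

lemma termF_integral (M β σ a b : ℝ) (hβ : 0 < β) (hσ : 0 < σ) (hM : 0 < M) :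
    ∫ x, termF M β σ a b x = rexp (-π * a ^ 2) / M * (rexp (-π * b ^ 2) / M) *
      mehlerK ((√(1 + β ^ 2) * √(1 + σ ^ 2))⁻¹) (√(2 * π) * a) (√(2 * π) * b) := by
  simp_rw [fun x => termF_eq M β σ a b x hβ hσ]
  rw [MeasureTheory.integral_const_mul, rgauss _ (by positivity)]
  have hp : √(1 + β ^ 2) ^ 2 = 1 + β ^ 2 := Real.sq_sqrt (by positivity)
  have hq : √(1 + σ ^ 2) ^ 2 = 1 + σ ^ 2 := Real.sq_sqrt (by positivity)
  have hp0 : 0 < √(1 + β ^ 2) := by positivity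
  have hq0 : 0 < √(1 + σ ^ 2) := by positivity
  have hs : √(2 * π) ^ 2 = 2 * π := Real.sq_sqrt (by positivity)
  have hD : 0 < β ^ 2 + σ ^ 2 + β ^ 2 * σ ^ 2 := by positivity
  unfold mehlerK
  rw [mul_pow (√(2 * π)) a, mul_pow (√(2 * π)) b, hs, show ∀ r : ℝ, 2 * r * (√(2 * π) * a) * (√(2 * π) * b) =
    2 * r * √(2 * π) ^ 2 * a * b by intros; ring, hs]
  have hr2 : 1 - ((√(1 + β ^ 2) * √(1 + σ ^ 2))⁻¹) ^ 2 =
      (β ^ 2 + σ ^ 2 + β ^ 2 * σ ^ 2) / (√(1 + β ^ 2) * √(1 + σ ^ 2)) ^ 2 := by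
    field_simp
    rw [hp, hq]; ring
  have e1 : √(π / (π * (1 + 1 / β ^ 2 + 1 / σ ^ 2))) = β * σ / √(β ^ 2 + σ ^ 2 + β ^ 2 * σ ^ 2) := by
    rw [show π / (π * (1 + 1 / β ^ 2 + 1 / σ ^ 2)) = (β * σ) ^ 2 / (β ^ 2 + σ ^ 2 + β ^ 2 * σ ^ 2) by
      field_simp; ring]
    rw [Real.sqrt_div (by positivity), Real.sqrt_sq (by positivity)]
  have e2 : √(1 - ((√(1 + β ^ 2) * √(1 + σ ^ 2))⁻¹) ^ 2) =
      √(β ^ 2 + σ ^ 2 + β ^ 2 * σ ^ 2) / (√(1 + β ^ 2) * √(1 + σ ^ 2)) := by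
    rw [hr2, Real.sqrt_div (by positivity), Real.sqrt_sq (by positivity)]
  rw [e1, e2, hr2]
  have hD0 : 0 < √(β ^ 2 + σ ^ 2 + β ^ 2 * σ ^ 2) := by positivity
  generalize √(β ^ 2 + σ ^ 2 + β ^ 2 * σ ^ 2) = D at *
  rw [show ∀ A B C E : ℝ, A / M * (B / M) * ((D / C)⁻¹ * E) = C / D / M ^ 2 * (A * B * E) by
    intros; field_simp, ← Real.exp_add, ← Real.exp_add, ← mul_assoc]
  congr 1
  · field_simp
  · congr 1
    have hp' : 1 + β ^ 2 = √(1 + β ^ 2) ^ 2 := hp.symm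
    have hb2 : β ^ 2 = √(1 + β ^ 2) ^ 2 - 1 := by linarith
    have hs2 : σ ^ 2 = √(1 + σ ^ 2) ^ 2 - 1 := by linarith
    have hβ2 : 0 < β ^ 2 := by positivity
    have hσ2 : 0 < σ ^ 2 := by positivity
    rw [← hp, ← hq]
    rw [Real.sqrt_sq hp0.le, Real.sqrt_sq hq0.le]
    generalize √(1 + β ^ 2) = p at *
    generalize √(1 + σ ^ 2) = q at *
    generalize β ^ 2 = B at *
    generalize σ ^ 2 = S at *
    subst hb2 hs2
    have h1 : p ^ 2 - 1 ≠ 0 := hβ2.ne'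
    have h2 : q ^ 2 - 1 ≠ 0 := hσ2.ne'
    have h3 : p ^ 2 * q ^ 2 - 1 ≠ 0 := by
      intro h; apply hD.ne'; linarith
    rw [show p ^ 2 - 1 + (q ^ 2 - 1) + (p ^ 2 - 1) * (q ^ 2 - 1) = p ^ 2 * q ^ 2 - 1 by ring]
    rw [show 1 + 1 / (p ^ 2 - 1) + 1 / (q ^ 2 - 1) = (p ^ 2 * q ^ 2 - 1) / ((p ^ 2 - 1) * (q ^ 2 - 1)) by
      field_simp; ring]
    field_simp
    ring

lemma hermiteQ_eq (n : ℕ) (x : ℝ) : hermiteQ n x = hermR n (√(2 * π) * x) / √(n.factorial) := rfl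

lemma overlap_hasSum (γ β σ : ℝ) (hγ : 0 < γ) (hβ : 0 < β) (hσ : 0 < σ) :
    HasSum (fun k : ℕ => (hermiteCoeff γ k) ^ 2 / ((1 + β ^ 2) ^ k * (1 + σ ^ 2) ^ k))
      (∫ x : ℝ, Real.exp (-Real.pi * x ^ 2) * pancakeLR γ β x * pancakeLR γ σ x) := by
  have hM := latticeMass_pos γ hγ
  set ρ : ℝ := (√(1 + β ^ 2) * √(1 + σ ^ 2))⁻¹ with hρ
  have hp1 : 1 < √(1 + β ^ 2) := by rw [Real.lt_sqrt (by norm_num)]; nlinarith [sq_pos_of_pos hβ]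
  have hq1 : 1 < √(1 + σ ^ 2) := by rw [Real.lt_sqrt (by norm_num)]; nlinarith [sq_pos_of_pos hσ]
  have h0 : 0 < ρ := by positivity
  have h1 : ρ < 1 := inv_lt_one_of_one_lt₀ (by nlinarith)
  have hρ2 : ρ ^ 2 = ((1 + β ^ 2) * (1 + σ ^ 2))⁻¹ := by
    rw [hρ, inv_pow, mul_pow, Real.sq_sqrt (by positivity), Real.sq_sqrt (by positivity)]
  obtain ⟨hs, hsum⟩ := mehler_double ρ h0 h1 (wt γ) (fun j => √(2 * π) * (j / γ))
    (fun j => by unfold wt; positivity) (summable_wt γ hγ) (summable_wtK γ hγ ρ h0 h1)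
  -- the integral
  have hInteg : (∫ x : ℝ, Real.exp (-Real.pi * x ^ 2) * pancakeLR γ β x * pancakeLR γ σ x) =
      ∑' p : ℤ × ℤ, wt γ p.1 * wt γ p.2 * mehlerK ρ (√(2 * π) * (p.1 / γ)) (√(2 * π) * (p.2 / γ)) := by
    have hi : ∀ p : ℤ × ℤ, ∫ x, termF (latticeMass γ) β σ (p.1 / γ) (p.2 / γ) x =
        wt γ p.1 * wt γ p.2 * mehlerK ρ (√(2 * π) * (p.1 / γ)) (√(2 * π) * (p.2 / γ)) := fun p =>
      termF_integral _ _ _ _ _ hβ hσ hM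
    have hnn : ∀ (p : ℤ × ℤ) x, ‖termF (latticeMass γ) β σ (p.1 / γ) (p.2 / γ) x‖ =
        termF (latticeMass γ) β σ (p.1 / γ) (p.2 / γ) x := fun p x =>
      Real.norm_of_nonneg (by unfold termF; positivity)
    have key := MeasureTheory.hasSum_integral_of_summable_integral_norm
      (μ := MeasureTheory.volume) (F := fun (p : ℤ × ℤ) x => termF (latticeMass γ) β σ (p.1 / γ) (p.2 / γ) x)
      (fun p => termF_integrable _ _ _ _ _ hβ hσ)
      (by simp_rw [hnn, hi]; exact hs)
    simp_rw [hi] at key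
    rw [key.tsum_eq]
    congr 1
    ext x
    have sg : ∀ τ : ℝ, 0 < τ → Summable fun k : ℤ => ‖√(1 + τ ^ 2) / (τ * latticeMass γ) *
        rexp (-π * (x - √(1 + τ ^ 2) * (k / γ)) ^ 2 / τ ^ 2)‖ := by
      intro τ hτ
      refine ((summable_gauss_shift (π / τ ^ 2) x (√(1 + τ ^ 2) / γ) (by positivity) (by positivity)).mul_left
        (√(1 + τ ^ 2) / (τ * latticeMass γ))).congr fun k => ?_
      rw [Real.norm_of_nonneg (by positivity)]
      congr 2
      ring
    have hLR : ∀ τ : ℝ, pancakeLR γ τ x = ∑' k : ℤ, √(1 + τ ^ 2) / (τ * latticeMass γ) *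
        rexp (-π * (x - √(1 + τ ^ 2) * (k / γ)) ^ 2 / τ ^ 2) := by
      intro τ
      unfold pancakeLR
      rw [← tsum_mul_left]
      simp_rw [mul_div_assoc]
    rw [hLR, hLR, mul_assoc, tsum_mul_tsum_of_summable_norm (sg β hβ) (sg σ hσ), ← tsum_mul_left]
    congr 1
    ext p
    unfold termF
    ring
  rw [hInteg]
  -- discard odd terms
  have hodd : ∀ n : ℕ, n ∉ Set.range (fun k : ℕ => 2 * k) →
      ρ ^ n / n.factorial * (∑' j : ℤ, wt γ j * hermR n (√(2 * π) * (j / γ))) ^ 2 = 0 := by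
    intro n hn
    have hno : Odd n := by
      rw [← Nat.not_even_iff_odd]
      rintro ⟨m, hm⟩
      exact hn ⟨m, by simp only; omega⟩
    have hz : ∑' j : ℤ, wt γ j * hermR n (√(2 * π) * (j / γ)) = 0 := by
      have h := (Equiv.neg ℤ).tsum_eq (fun j : ℤ => wt γ j * hermR n (√(2 * π) * (j / γ)))
      have e : ∀ j : ℤ, wt γ ((Equiv.neg ℤ) j) * hermR n (√(2 * π) * (((Equiv.neg ℤ) j : ℤ) / γ)) =
          -(wt γ j * hermR n (√(2 * π) * (j / γ))) := by
        intro j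
        have : √(2 * π) * ((((Equiv.neg ℤ) j : ℤ) : ℝ) / γ) = -(√(2 * π) * (j / γ)) := by
          simp only [Equiv.neg_apply]; push_cast; ring
        rw [this, hermR_neg, hno.neg_one_pow]
        have : wt γ ((Equiv.neg ℤ) j) = wt γ j := by
          unfold wt; simp only [Equiv.neg_apply]; push_cast; congr 2; ring
        rw [this]; ring
      simp_rw [e] at h
      rw [tsum_neg] at h
      linarith
    rw [hz]; simp
  have hinj : Function.Injective (fun k : ℕ => 2 * k) := fun a b h => by simpa using h
  have h2 := (hinj.hasSum_iff hodd).2 hsum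
  refine h2.congr_fun fun k => ?_
  have hc : hermiteCoeff γ k =
      (∑' j : ℤ, wt γ j * hermR (2 * k) (√(2 * π) * (j / γ))) / √((2 * k).factorial) := by
    unfold hermiteCoeff
    rw [← tsum_div_const]
    congr 1; ext j
    rw [hermiteQ_eq]; unfold wt; ring
  simp only [Function.comp]
  rw [hc, div_pow, Real.sq_sqrt (by positivity), pow_mul ρ, hρ2, inv_pow, mul_pow]
  field_simp

/-- Monotonicity of the smoothed likelihood-ratio overlap
`G(σ) = ⟨T_γ^β, T_γ^σ⟩_Q = ∫ exp(-πx²) T_γ^β(x) T_γ^σ(x) dx`: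
`G(σ) = Σ_k α_{2k}²/((1+β²)^k (1+σ²)^k)` and `G` is strictly decreasing on `(0,∞)`
provided some `α_{2k}` with `k ≥ 1` is nonzero. -/
theorem overlap_monotone (γ β : ℝ) (hγ : 0 < γ) (hβ : 0 < β) :
    (∀ σ : ℝ, 0 < σ →
      (∫ x : ℝ, Real.exp (-Real.pi * x ^ 2) * pancakeLR γ β x * pancakeLR γ σ x)
        = ∑' k : ℕ, (hermiteCoeff γ k) ^ 2 / ((1 + β ^ 2) ^ k * (1 + σ ^ 2) ^ k)) ∧
    ((∃ k : ℕ, 1 ≤ k ∧ hermiteCoeff γ k ≠ 0) →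
      StrictAntiOn
        (fun σ : ℝ => ∫ x : ℝ, Real.exp (-Real.pi * x ^ 2) * pancakeLR γ β x * pancakeLR γ σ x)
        (Set.Ioi (0 : ℝ))) := by
  refine ⟨fun σ hσ => (overlap_hasSum γ β σ hγ hβ hσ).tsum_eq.symm, ?_⟩
  rintro ⟨k, hk, hne⟩ s hs t ht hst
  have hs0 : 0 < s := hs
  have ht0 : 0 < t := ht
  have H1 := overlap_hasSum γ β s hγ hβ hs0
  have H2 := overlap_hasSum γ β t hγ hβ ht0
  have hst2 : 1 + s ^ 2 < 1 + t ^ 2 := by nlinarith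
  simp only
  refine hasSum_lt (i := k) (fun n => ?_) ?_ H2 H1
  · simp only
    gcongr
  · have : 0 < hermiteCoeff γ k ^ 2 := by positivity
    have hk0 : k ≠ 0 := by omega
    gcongr
end

section
/- Non-trivial Hermite coefficient of the discrete Gaussian: for any γ > 1 with πγ² ∈ ℕ and any ℓ ∈ ℕ, setting k = 2πℓ²γ², the Hermite coefficient satisfies |E_{x ∼ A_γ}[h_k(x)]| ≥ 1/√(2π ℓ γ), where (h_k) are Hermite polynomials orthonormal with respect to N(0, 1/(2π)) and A_γ is the discrete Gaussian on (1/γ)ℤ. -/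
open Real

open Filter Asymptotics MeasureTheory Topology FourierTransform

/-- polynomial times Gaussian -/
noncomputable def pgauss (a : ℝ) (p : Polynomial ℝ) (x : ℝ) : ℝ := p.eval x * Real.exp (-a * x ^ 2)

lemma pgauss_isBigO {a : ℝ} (ha : 0 < a) (p : Polynomial ℝ) :
    (pgauss a p) =O[cocompact ℝ] (fun x : ℝ => |x| ^ (-2 : ℝ)) := by
  unfold pgauss
  induction p using Polynomial.induction_on' with
  | add p q hp hq =>
    simpa only [Polynomial.eval_add, add_mul] using hp.add hq
  | monomial n c =>
    simp only [Polynomial.eval_monomial]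
    have h1 : (fun x : ℝ => Real.exp (-a * x ^ 2)) =O[cocompact ℝ]
        (fun x : ℝ => |x| ^ (-2 - n : ℝ)) := by
      have := (cexp_neg_quadratic_isLittleO_abs_rpow_cocompact (a := ((-a : ℝ) : ℂ))
        (by simpa using ha) 0 (-2 - n : ℝ)).isBigO.norm_left
      refine this.congr_left fun x => ?_
      rw [zero_mul, add_zero, ← Complex.ofReal_pow, ← Complex.ofReal_mul, Complex.norm_exp,
        Complex.ofReal_re]
    have h2 : (fun x : ℝ => x ^ n) =O[cocompact ℝ] (fun x : ℝ => |x| ^ n) :=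
      IsBigO.of_bound 1 (Eventually.of_forall fun x => by simp)
    have h3 := (h2.mul h1).const_mul_left c
    refine (h3.congr_left fun x => by ring).trans_eventuallyEq ?_
    have hne : ∀ᶠ x : ℝ in cocompact ℝ, x ≠ 0 := by
      have := (isCompact_singleton (x := (0 : ℝ))).compl_mem_cocompact
      filter_upwards [this] with x hx using hx
    filter_upwards [hne] with x hx
    have hx' : 0 < |x| := abs_pos.mpr hx
    rw [← Real.rpow_natCast, ← Real.rpow_add hx']
    congr 1; ring

lemma pgauss_integrable {a : ℝ} (ha : 0 < a) (p : Polynomial ℝ) : Integrable (pgauss a p) := by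
  unfold pgauss
  induction p using Polynomial.induction_on' with
  | add p q hp hq =>
    simp only [Polynomial.eval_add, add_mul]
    exact hp.add hq
  | monomial n c =>
    have h := (integrable_rpow_mul_exp_neg_mul_sq ha (s := n)
      (by have : (0 : ℝ) ≤ n := n.cast_nonneg
          linarith)).const_mul c
    simpa only [Polynomial.eval_monomial, Real.rpow_natCast, mul_assoc] using h

lemma pgauss_summable {a : ℝ} (ha : 0 < a) (p : Polynomial ℝ) :
    Summable fun n : ℤ => pgauss a p n :=
  summable_of_isBigO (Real.summable_abs_int_rpow one_lt_two)
    ((pgauss_isBigO ha p).comp_tendsto Int.tendsto_coe_cofinite)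

lemma pgauss_hasDerivAt (a : ℝ) (p : Polynomial ℝ) (x : ℝ) :
    HasDerivAt (pgauss a p)
      (pgauss a (Polynomial.derivative p - Polynomial.C (2 * a) * Polynomial.X * p) x) x := by
  unfold pgauss
  have h1 := p.hasDerivAt x
  have h2 : HasDerivAt (fun x : ℝ => Real.exp (-a * x ^ 2))
      (Real.exp (-a * x ^ 2) * (-a * (2 * x))) x := by
    have := ((hasDerivAt_pow 2 x).const_mul (-a)).exp
    simpa using this
  convert! h1.mul h2 using 1
  simp
  ring

/-- scaled Hermite polynomial -/
noncomputable def hp (s : ℝ) (n : ℕ) : Polynomial ℝ :=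
  ((Polynomial.hermite n).map (Int.castRingHom ℝ)).comp (Polynomial.C s * Polynomial.X)

lemma hp_succ (s : ℝ) (n : ℕ) :
    Polynomial.derivative (hp s n) - Polynomial.C (2 * (s ^ 2 / 2)) * Polynomial.X * hp s n
      = Polynomial.C (-s) * hp s (n + 1) := by
  have : 2 * (s ^ 2 / 2) = s * s := by ring
  rw [this]
  simp only [hp, Polynomial.hermite_succ, Polynomial.derivative_comp, Polynomial.map_sub,
    Polynomial.map_mul, Polynomial.map_X, Polynomial.sub_comp, Polynomial.mul_comp,
    Polynomial.X_comp, Polynomial.derivative_map, map_neg, map_mul]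
  simp
  ring

lemma pgauss_cderiv (s : ℝ) (n : ℕ) (x : ℝ) :
    HasDerivAt (fun x : ℝ => (pgauss (s ^ 2 / 2) (hp s n) x : ℂ))
      ((-s : ℂ) * (pgauss (s ^ 2 / 2) (hp s (n + 1)) x : ℂ)) x := by
  have := (pgauss_hasDerivAt (s ^ 2 / 2) (hp s n) x).ofReal_comp
  rw [hp_succ] at this
  convert! this using 1
  simp [pgauss, mul_assoc]

lemma pgauss_fourier {s : ℝ} (hs : 0 < s) (n : ℕ) (t : ℝ) :
    𝓕 (fun x : ℝ => (pgauss (s ^ 2 / 2) (hp s n) x : ℂ)) t =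
      (-Complex.I * (2 * Real.pi / s * t : ℝ)) ^ n *
        ((Real.sqrt (2 * Real.pi) / s * Real.exp (-(2 * Real.pi ^ 2 / s ^ 2) * t ^ 2) : ℝ) : ℂ) := by
  have ha : 0 < s ^ 2 / 2 := by positivity
  have hpi := Real.pi_pos
  have hsc : (s : ℂ) ≠ 0 := by exact_mod_cast hs.ne'
  induction n with
  | zero =>
    set b : ℝ := s ^ 2 / (2 * Real.pi) with hb
    have hb0 : 0 < b := by positivity
    have h := congrFun (fourier_gaussian_pi (b := (b : ℂ)) (by simpa using hb0)) t
    have e1 : (fun x : ℝ => (pgauss (s ^ 2 / 2) (hp s 0) x : ℂ)) =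
        fun x : ℝ => Complex.exp (-Real.pi * b * x ^ 2) := by
      funext x
      have : -Real.pi * b * x ^ 2 = -(s ^ 2 / 2) * x ^ 2 := by rw [hb]; field_simp
      simp only [pgauss, hp, Polynomial.hermite_zero]
      rw [show (-(Real.pi : ℂ) * b * x ^ 2) = ((-Real.pi * b * x ^ 2 : ℝ) : ℂ) by push_cast; ring,
        this]
      simp
    rw [e1, h, pow_zero, one_mul]
    have e2 : (b : ℂ) ^ (1 / 2 : ℂ) = ((Real.sqrt b : ℝ) : ℂ) := by
      rw [Real.sqrt_eq_rpow, Complex.ofReal_cpow hb0.le]; simp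
    have e3 : Real.sqrt b = s / Real.sqrt (2 * Real.pi) := by
      rw [hb, Real.sqrt_div (by positivity), Real.sqrt_sq hs.le]
    have e4 : (-(Real.pi : ℂ) / b * t ^ 2) = ((-(2 * Real.pi ^ 2 / s ^ 2) * t ^ 2 : ℝ) : ℂ) := by
      rw [show -(2 * Real.pi ^ 2 / s ^ 2) * t ^ 2 = -Real.pi / b * t ^ 2 by rw [hb]; field_simp]
      push_cast; ring
    rw [e2, e3, e4]
    push_cast
    rw [one_div_div]
  | succ n ih =>
    have hI := (pgauss_integrable ha (hp s n)).ofReal (𝕜 := ℂ)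
    have hI' := (pgauss_integrable ha (hp s (n + 1))).ofReal (𝕜 := ℂ)
    have hd : deriv (fun x : ℝ => (pgauss (s ^ 2 / 2) (hp s n) x : ℂ)) =
        (-s : ℂ) • (fun x : ℝ => (pgauss (s ^ 2 / 2) (hp s (n + 1)) x : ℂ)) := by
      funext x
      exact (pgauss_cderiv s n x).deriv
    have h := congrFun (Real.fourier_deriv hI
      (fun x => (pgauss_cderiv s n x).differentiableAt) (by
        change Integrable (deriv (fun x : ℝ => (pgauss (s ^ 2 / 2) (hp s n) x : ℂ)))
        rw [hd]; exact hI'.smul _)) t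
    change 𝓕 (deriv (fun x : ℝ => (pgauss (s ^ 2 / 2) (hp s n) x : ℂ))) t =
      (2 * Real.pi * Complex.I * t) •
        𝓕 (fun x : ℝ => (pgauss (s ^ 2 / 2) (hp s n) x : ℂ)) t at h
    rw [hd, Real.fourier_eq] at h
    simp only [Pi.smul_apply, smul_comm _ (-s : ℂ)] at h
    rw [integral_smul, ← Real.fourier_eq, ih, smul_eq_mul, smul_eq_mul] at h
    have hs' : (-s : ℂ) ≠ 0 := neg_ne_zero.mpr hsc
    apply mul_left_cancel₀ hs'
    rw [h, pow_succ]
    push_cast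
    field_simp
    rw [pow_succ]
    field_simp

lemma exp_neg_three_le : Real.exp (-3) ≤ 1 / 8 := by
   have := Real.exp_one_gt_d9
   have h : Real.exp (-3) = (Real.exp 1 ^ 3)⁻¹ := by
     rw [Real.exp_neg, ← Real.exp_nat_mul]; norm_num
   rw [h, inv_le_comm₀ (by positivity) (by norm_num)]
   calc (1 / 8 : ℝ)⁻¹ = 2 ^ 3 := by norm_num
     _ ≤ _ := by gcongr; linarith

lemma mass_bound {c : ℝ} (hc : 3 ≤ c) :
    ∑' n : ℤ, Real.exp (-c * (n : ℝ) ^ 2) ≤ 9 / 7 := by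
  obtain ⟨q, hq⟩ : ∃ q : ℝ, q = 1 / 8 := ⟨_, rfl⟩
  have he := exp_neg_three_le
  have hb : ∀ n : ℕ, Real.exp (-c * (n : ℝ) ^ 2) ≤ q ^ n := by
    intro n
    calc Real.exp (-c * (n : ℝ) ^ 2) ≤ Real.exp (n * (-3)) := by
          apply Real.exp_le_exp.mpr
          have : (n : ℝ) ≤ (n : ℝ) ^ 2 := by
            exact_mod_cast Nat.le_self_pow (by norm_num) n
          nlinarith
      _ = Real.exp (-3) ^ n := by rw [Real.exp_nat_mul]
      _ ≤ q ^ n := by rw [hq]; gcongr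
  have hg : HasSum (fun n : ℕ => q ^ n) (8 / 7) := by
    have := hasSum_geometric_of_lt_one (r := q) (by norm_num [hq]) (by norm_num [hq])
    convert this using 1; norm_num [hq]
  have hg1 : HasSum (fun n : ℕ => q ^ (n + 1)) (1 / 7) := by
    have := hg.mul_left q
    convert! this using 1
    · funext n; ring
    · norm_num [hq]
  have hs0 : Summable fun n : ℕ => Real.exp (-c * ((n : ℤ) : ℝ) ^ 2) :=
    Summable.of_nonneg_of_le (fun _ => (Real.exp_pos _).le) (fun n => by simpa using hb n) hg.summable
  have hb1 : ∀ n : ℕ, Real.exp (-c * ((-(n + 1 : ℤ) : ℤ) : ℝ) ^ 2) ≤ q ^ (n + 1) := by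
    intro n
    refine le_trans (le_of_eq ?_) (hb (n + 1))
    push_cast; congr 1; ring
  have hs1 : Summable fun n : ℕ => Real.exp (-c * ((-(n + 1 : ℤ) : ℤ) : ℝ) ^ 2) :=
    Summable.of_nonneg_of_le (fun _ => (Real.exp_pos _).le) hb1 hg1.summable
  rw [tsum_of_nat_of_neg_add_one (f := fun n : ℤ => Real.exp (-c * (n : ℝ) ^ 2)) hs0 hs1]
  have a1 : ∑' n : ℕ, Real.exp (-c * ((n : ℤ) : ℝ) ^ 2) ≤ 8 / 7 :=
    hasSum_le (fun n => by simpa using hb n) hs0.hasSum hg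
  have a2 : ∑' n : ℕ, Real.exp (-c * ((-(n + 1 : ℤ) : ℤ) : ℝ) ^ 2) ≤ 1 / 7 :=
    hasSum_le hb1 hs1.hasSum hg1
  calc _ ≤ (8 / 7 + 1 / 7 : ℝ) := add_le_add a1 a2
    _ = 9 / 7 := by norm_num

lemma stirling_upper {k : ℕ} (hk : k ≠ 0) :
    (k.factorial : ℝ) ≤ Real.exp 1 * Real.sqrt k * (k / Real.exp 1) ^ k := by
  obtain ⟨n, rfl⟩ := Nat.exists_eq_succ_of_ne_zero hk
  have h := Stirling.stirlingSeq'_antitone (Nat.zero_le n)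
  simp only [Function.comp_apply, Nat.succ_eq_add_one, zero_add, Stirling.stirlingSeq_one] at h
  rw [Stirling.stirlingSeq, div_le_iff₀ (by positivity), Real.sqrt_mul (by norm_num)] at h
  refine h.trans (le_of_eq ?_)
  have : Real.sqrt 2 ≠ 0 := by positivity
  field_simp

lemma poisson_even {γ : ℝ} (hγ : 0 < γ) (h : ℕ) :
    ∑' j : ℤ, pgauss (Real.pi / γ ^ 2) (hp (Real.sqrt (2 * Real.pi) / γ) (2 * h)) j =
      (-1) ^ h * (γ * ∑' n : ℤ, (2 * Real.pi * γ ^ 2 * (n : ℝ) ^ 2) ^ h *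
        Real.exp (-(Real.pi * γ ^ 2) * (n : ℝ) ^ 2)) ∧
    Summable (fun n : ℤ => (2 * Real.pi * γ ^ 2 * (n : ℝ) ^ 2) ^ h *
        Real.exp (-(Real.pi * γ ^ 2) * (n : ℝ) ^ 2)) := by
  have hpi := Real.pi_pos
  have h2 : Real.sqrt (2 * Real.pi) ^ 2 = 2 * Real.pi := Real.sq_sqrt (by positivity)
  have h2pos : 0 < Real.sqrt (2 * Real.pi) := by positivity
  obtain ⟨s, hs⟩ : ∃ s, s = Real.sqrt (2 * Real.pi) / γ := ⟨_, rfl⟩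
  have hs0 : 0 < s := by rw [hs]; positivity
  have hsa : Real.pi / γ ^ 2 = s ^ 2 / 2 := by rw [hs, div_pow, h2]; field_simp
  have hsum : Summable (fun n : ℤ => (2 * Real.pi * γ ^ 2 * (n : ℝ) ^ 2) ^ h *
        Real.exp (-(Real.pi * γ ^ 2) * (n : ℝ) ^ 2)) := by
    have := pgauss_summable (a := Real.pi * γ ^ 2) (by positivity)
      ((Polynomial.C (2 * Real.pi * γ ^ 2) * Polynomial.X ^ 2) ^ h)
    simpa [pgauss] using this
  refine ⟨?_, hsum⟩
  have hF : ∀ n : ℤ, 𝓕 (fun x : ℝ => (pgauss (s ^ 2 / 2) (hp s (2 * h)) x : ℂ)) n =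
      (((-1) ^ h * (γ * ((2 * Real.pi * γ ^ 2 * (n : ℝ) ^ 2) ^ h *
        Real.exp (-(Real.pi * γ ^ 2) * (n : ℝ) ^ 2))) : ℝ) : ℂ) := by
    intro n
    rw [pgauss_fourier hs0, pow_mul, mul_pow, neg_sq, Complex.I_sq, mul_pow, ← Complex.ofReal_pow]
    have e1 : (2 * Real.pi / s * (n : ℝ)) ^ 2 = 2 * Real.pi * γ ^ 2 * (n : ℝ) ^ 2 := by
      rw [hs, mul_pow, div_pow, div_pow, h2]; field_simp
    have e2 : Real.sqrt (2 * Real.pi) / s = γ := by rw [hs]; field_simp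
    have e3 : 2 * Real.pi ^ 2 / s ^ 2 = Real.pi * γ ^ 2 := by
      rw [hs, div_pow, h2]; field_simp
    rw [e1, e2, e3]
    push_cast; ring
  rw [hsa, ← hs]
  have hcont : Continuous (fun x : ℝ => (pgauss (s ^ 2 / 2) (hp s (2 * h)) x : ℂ)) := by
    unfold pgauss; fun_prop
  have hO : (fun x : ℝ => (pgauss (s ^ 2 / 2) (hp s (2 * h)) x : ℂ)) =O[cocompact ℝ]
      (fun x : ℝ => |x| ^ (-2 : ℝ)) := by
    refine IsBigO.of_norm_left ?_
    simpa only [Complex.norm_real] using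
      (pgauss_isBigO (a := s ^ 2 / 2) (by positivity) (hp s (2 * h))).norm_left
  have hFs : Summable fun n : ℤ =>
      𝓕 (fun x : ℝ => (pgauss (s ^ 2 / 2) (hp s (2 * h)) x : ℂ)) n := by
    simp only [hF]
    exact Complex.hasSum_ofReal.mpr ((hsum.mul_left γ).mul_left ((-1) ^ h)).hasSum |>.summable
  have key := Real.tsum_eq_tsum_fourier_of_rpow_decay_of_summable hcont one_lt_two hO hFs 0
  simp only [hF, zero_add] at key
  simp only [QuotientAddGroup.mk_zero, fourier_eval_zero, mul_one] at key
  rw [← Complex.ofReal_tsum, ← Complex.ofReal_tsum, Complex.ofReal_inj, tsum_mul_left,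
    tsum_mul_left] at key
  exact key

/-- Non-trivial Hermite coefficient of the discrete Gaussian: if `γ > 1` with
`πγ² = m ∈ ℕ` and `ℓ ∈ ℕ`, then for degree `k = 2πℓ²γ² = 2ℓ²m`,
`|E_{x∼A_γ}[h_k(x)]| ≥ 1/√(2πℓγ)`. -/
theorem discreteGaussian_hermiteCoeff_lower (γ : ℝ) (hγ : 1 < γ) (m : ℕ)
    (hm : (m : ℝ) = Real.pi * γ ^ 2) (ℓ : ℕ) :
    (1 : ℝ) / Real.sqrt (2 * Real.pi * ℓ * γ) ≤
      |∑' j : ℤ, (Real.exp (-Real.pi * ((j : ℝ) / γ) ^ 2) / latticeMass γ) *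
        hermiteQ (2 * ℓ ^ 2 * m) ((j : ℝ) / γ)| := by
  rcases Nat.eq_zero_or_pos ℓ with rfl | hℓ
  · simp
  have hpi := Real.pi_pos
  have hγ0 : 0 < γ := by linarith
  have hm0 : (0 : ℝ) < m := by rw [hm]; positivity
  have hℓ0 : (0 : ℝ) < ℓ := by exact_mod_cast hℓ
  obtain ⟨h, hh⟩ : ∃ h, h = ℓ ^ 2 * m := ⟨_, rfl⟩
  rw [show 2 * ℓ ^ 2 * m = 2 * h by rw [hh]; ring]
  have hhR : (h : ℝ) = ℓ ^ 2 * (Real.pi * γ ^ 2) := by rw [hh]; push_cast; rw [hm]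
  have hh0 : (0 : ℝ) < h := by rw [hhR]; positivity
  -- the mass
  obtain ⟨M, hM⟩ : ∃ M, M = ∑' n : ℤ, Real.exp (-(Real.pi * γ ^ 2) * (n : ℝ) ^ 2) := ⟨_, rfl⟩
  have hMle : M ≤ 9 / 7 := by
    rw [hM]; apply mass_bound
    nlinarith [Real.pi_gt_three]
  have hmass : latticeMass γ = γ * M := by
    have := Real.tsum_exp_neg_mul_int_sq (a := 1 / γ ^ 2) (by positivity)
    rw [latticeMass, hM]
    have e : (1 / γ ^ 2) ^ (1 / 2 : ℝ) = 1 / γ := by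
      rw [← Real.sqrt_eq_rpow, Real.sqrt_div zero_le_one, Real.sqrt_sq hγ0.le, Real.sqrt_one]
    rw [e, one_div_one_div] at this
    have e1 : ∀ k : ℤ, -Real.pi * ((k : ℝ) / γ) ^ 2 = -Real.pi * (1 / γ ^ 2) * (k : ℝ) ^ 2 := by
      intro k; field_simp
    have e2 : ∀ k : ℤ, -(Real.pi * γ ^ 2) * (k : ℝ) ^ 2 =
        -Real.pi / (1 / γ ^ 2) * (k : ℝ) ^ 2 := by
      intro k; field_simp
    simp only [e1, e2]
    exact this
  obtain ⟨hP, hS⟩ := poisson_even hγ0 h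
  have hM0 : 0 < M := by
    have hS0 := (poisson_even hγ0 0).2
    simp only [pow_zero, one_mul] at hS0
    rw [hM]
    exact hS0.tsum_pos (fun _ => (Real.exp_pos _).le) 0 (Real.exp_pos _)
  obtain ⟨S, hSdef⟩ : ∃ S, S = ∑' n : ℤ, (2 * Real.pi * γ ^ 2 * (n : ℝ) ^ 2) ^ h *
        Real.exp (-(Real.pi * γ ^ 2) * (n : ℝ) ^ 2) := ⟨_, rfl⟩
  have hSlow : 2 * ((2 * h : ℝ) ^ h * Real.exp (-h)) ≤ S := by
    have := hS.sum_le_tsum {(ℓ : ℤ), -(ℓ : ℤ)} (fun _ _ => by positivity)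
    rw [Finset.sum_pair (by omega), ← hSdef] at this
    push_cast at this
    rw [neg_sq, show 2 * Real.pi * γ ^ 2 * (ℓ : ℝ) ^ 2 = 2 * h by rw [hhR]; ring,
      show -(Real.pi * γ ^ 2) * (ℓ : ℝ) ^ 2 = -h by rw [hhR]; ring] at this
    linarith
  have hE : ∑' j : ℤ, (Real.exp (-Real.pi * ((j : ℝ) / γ) ^ 2) / latticeMass γ) *
        hermiteQ (2 * h) ((j : ℝ) / γ) =
      (-1) ^ h * (S / (M * Real.sqrt ((2 * h).factorial))) := by
    have : ∀ j : ℤ, (Real.exp (-Real.pi * ((j : ℝ) / γ) ^ 2) / latticeMass γ) *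
        hermiteQ (2 * h) ((j : ℝ) / γ) =
        (1 / (γ * M * Real.sqrt ((2 * h).factorial))) *
          pgauss (Real.pi / γ ^ 2) (hp (Real.sqrt (2 * Real.pi) / γ) (2 * h)) j := by
      intro j
      rw [hmass, hermiteQ, pgauss, hp, Polynomial.eval_comp]
      simp only [Polynomial.eval_mul, Polynomial.eval_C, Polynomial.eval_X]
      rw [show Real.sqrt (2 * Real.pi) / γ * (j : ℝ) = Real.sqrt (2 * Real.pi) * (j / γ) by ring,
        show -(Real.pi / γ ^ 2) * (j : ℝ) ^ 2 = -Real.pi * (j / γ) ^ 2 by ring]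
      field_simp
    simp only [this]
    rw [tsum_mul_left, hP, ← hSdef]
    field_simp
  rw [hE, abs_mul, abs_pow, abs_neg, abs_one, one_pow, one_mul]
  have hS0 : 0 < S := lt_of_lt_of_le (by positivity) hSlow
  have hf0 : (0 : ℝ) < (2 * h).factorial := by exact_mod_cast Nat.factorial_pos _
  rw [abs_of_pos (by positivity), div_le_div_iff₀ (by positivity) (by positivity), one_mul]
  -- compare squares
  have hst := stirling_upper (k := 2 * h) (by have : 0 < h := by exact_mod_cast hh0
                                              omega)
  push_cast at hst
  obtain ⟨W, hW⟩ : ∃ W, W = (2 * h : ℝ) ^ h * Real.exp (-h) := ⟨_, rfl⟩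
  have hW0 : 0 < W := by rw [hW]; positivity
  have hW2 : (2 * h / Real.exp 1 : ℝ) ^ (2 * h) = W ^ 2 := by
    rw [hW, mul_comm 2 h, pow_mul, Real.exp_neg, ← Real.exp_one_pow]
    congr 1
    rw [div_pow]; ring
  rw [hW2] at hst
  rw [← hW] at hSlow
  obtain ⟨r, hr⟩ : ∃ r, r = Real.sqrt (2 * h) := ⟨_, rfl⟩
  have hr0 : 0 < r := by rw [hr]; positivity
  have hrle : 2 * r ≤ 2 * Real.pi * ℓ * γ := by
    have : r ≤ Real.pi * ℓ * γ := by
      rw [hr, hhR]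
      apply Real.sqrt_le_iff.mpr
      refine ⟨by positivity, ?_⟩
      have h3 := Real.pi_gt_three
      have : 0 < Real.pi * (ℓ : ℝ) ^ 2 * γ ^ 2 := by positivity
      nlinarith
    linarith
  rw [← hr] at hst
  have he := Real.exp_one_lt_d9
  refine abs_le_of_sq_le_sq' ?_ (by positivity) |>.2
  rw [mul_pow, mul_pow, Real.sq_sqrt hf0.le, Real.sq_sqrt (by positivity)]
  calc M ^ 2 * (2 * h).factorial ≤ (9 / 7) ^ 2 * (2.72 * r * W ^ 2) := by
        gcongr
        refine hst.trans ?_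
        gcongr
        linarith
    _ ≤ (2 * W) ^ 2 * (2 * r) := by
        have : 0 < r * W ^ 2 := by positivity
        nlinarith
    _ ≤ S ^ 2 * (2 * Real.pi * ℓ * γ) := by gcongr
end

section
/- Rounded-degree Hermite coefficient bound: for any γ > 1 and ℓ ∈ ℕ, setting k = 2⌊ℓ²πγ²⌋, the Hermite coefficient of the discrete Gaussian satisfies |E_{x∼A_γ}[h_k(x)]| ≥ 1/(e√(2πℓγ)), where (h_k) are the Hermite polynomials orthonormal with respect to N(0,1/(2π)). -/
open Real

open Filter Asymptotics MeasureTheory in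
lemma aux_poly_decay {b : ℝ} (hb : 0 < b) (q : Polynomial ℝ) :
    (fun x : ℝ => q.eval x * Real.exp (-b * x ^ 2)) =O[cocompact ℝ] fun x : ℝ => |x| ^ (-2 : ℝ) := by
  induction q using Polynomial.induction_on' with
  | add p q hp hq =>
    simpa [add_mul] using hp.add hq
  | monomial k a =>
    have h := (isLittleO_exp_neg_mul_sq_cocompact (a := (b : ℂ)) (by simpa using hb)
      (-2 - (k : ℝ))).isBigO
    have h' : (fun x : ℝ => Real.exp (-b * x ^ 2)) =O[cocompact ℝ]
        fun x : ℝ => |x| ^ (-2 - (k : ℝ)) := by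
      refine (IsBigO.of_norm_left ?_)
      refine h.norm_left.congr_left fun x => ?_
      rw [Complex.norm_exp, Real.norm_eq_abs, abs_of_pos (Real.exp_pos _)]
      congr 1
      rw [← Complex.ofReal_pow, ← Complex.ofReal_neg, ← Complex.ofReal_mul, Complex.ofReal_re]
    have h2 : (fun x : ℝ => a * x ^ k) =O[cocompact ℝ] fun x : ℝ => |x| ^ k := by
      refine IsBigO.const_mul_left ?_ a
      refine IsBigO.of_norm_left ?_
      simp only [norm_pow, Real.norm_eq_abs]
      exact isBigO_refl _ _
    have h3 := h2.mul h'
    simp only [Polynomial.eval_monomial]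
    refine h3.trans_eventuallyEq ?_
    have : ∀ᶠ x : ℝ in cocompact ℝ, x ≠ 0 := by
      have := (isCompact_singleton (x := (0:ℝ))).compl_mem_cocompact
      filter_upwards [this] with x hx
      simpa using hx
    filter_upwards [this] with x hx
    rw [← Real.rpow_natCast, ← Real.rpow_add (abs_pos.mpr hx)]
    congr 1; ring

open MeasureTheory in
lemma aux_poly_integrable {b : ℝ} (hb : 0 < b) (q : Polynomial ℝ) :
    Integrable (fun x : ℝ => q.eval x * Real.exp (-b * x ^ 2)) := by
  induction q using Polynomial.induction_on' with
  | add p q hp hq =>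
    refine (hp.add hq).congr (Filter.Eventually.of_forall fun x => ?_)
    simp [add_mul]
  | monomial k a =>
    have := (integrable_rpow_mul_exp_neg_mul_sq hb (s := (k:ℝ))
      (by have : (0:ℝ) ≤ k := k.cast_nonneg
          linarith)).const_mul a
    simpa [mul_assoc] using this

lemma aux_iter (c : ℝ) (n : ℕ) :
    iteratedDeriv n (fun x : ℝ => ((Real.exp (-(c ^ 2 / 2) * x ^ 2) : ℝ) : ℂ)) = fun x : ℝ =>
      (((Polynomial.C ((-c) ^ n) * (((Polynomial.hermite n).map (Int.castRingHom ℝ)).comp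
        (Polynomial.C c * Polynomial.X))).eval x * Real.exp (-(c ^ 2 / 2) * x ^ 2) : ℝ) : ℂ) := by
  induction n with
  | zero => simp
  | succ n ih =>
    rw [iteratedDeriv_succ, ih]
    funext x
    apply HasDerivAt.deriv
    apply HasDerivAt.ofReal_comp
    have h1 := Polynomial.hasDerivAt (Polynomial.C ((-c) ^ n) *
      (((Polynomial.hermite n).map (Int.castRingHom ℝ)).comp
        (Polynomial.C c * Polynomial.X))) x
    have h2 : HasDerivAt (fun x : ℝ => Real.exp (-(c ^ 2 / 2) * x ^ 2))
        (Real.exp (-(c ^ 2 / 2) * x ^ 2) * (-(c ^ 2 / 2) * (2 * x))) x := by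
      have := ((hasDerivAt_pow 2 x).const_mul (-(c ^ 2 / 2))).exp
      simpa using this
    refine (h1.mul h2).congr_deriv ?_
    rw [Polynomial.derivative_C_mul, pow_succ (-c) n]
    generalize (-c) ^ n = d
    simp [Polynomial.hermite_succ, Polynomial.derivative_comp, Polynomial.derivative_map]
    ring

open Filter Asymptotics MeasureTheory FourierTransform in
lemma aux_poisson {γ : ℝ} (hγ : 0 < γ) (m : ℕ) :
    (Summable fun j : ℤ => (j : ℝ) ^ (2 * m) * Real.exp (-(π * γ ^ 2) * (j : ℝ) ^ 2)) ∧
    ∑' j : ℤ, ((Polynomial.hermite (2 * m)).map (Int.castRingHom ℝ)).eval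
        (√(2 * π) * ((j : ℝ) / γ)) * Real.exp (-π * ((j : ℝ) / γ) ^ 2) =
      (-1) ^ m * (2 * π) ^ m * γ * γ ^ (2 * m) *
        ∑' j : ℤ, (j : ℝ) ^ (2 * m) * Real.exp (-(π * γ ^ 2) * (j : ℝ) ^ 2) := by
  have hπ := Real.pi_pos
  set c : ℝ := √(2 * π) / γ with hc
  have hc2 : c ^ 2 = 2 * π / γ ^ 2 := by
    rw [hc, div_pow, Real.sq_sqrt (by positivity)]
  have hcpos : 0 < c := by positivity
  have hb : 0 < c ^ 2 / 2 := by positivity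
  have hB : 0 < π * γ ^ 2 := by positivity
  set F : ℝ → ℂ := fun x : ℝ => ((Real.exp (-(c ^ 2 / 2) * x ^ 2) : ℝ) : ℂ) with hF
  set Q : Polynomial ℝ := (Polynomial.C ((-c) ^ (2 * m)) *
    (((Polynomial.hermite (2 * m)).map (Int.castRingHom ℝ)).comp
        (Polynomial.C c * Polynomial.X))) with hQ
  have hG := aux_iter c (2 * m)
  rw [← hF, ← hQ] at hG
  have hFcd : ContDiff ℝ (⊤ : ℕ∞) F := by
    have : ContDiff ℝ (⊤ : ℕ∞) (fun x : ℝ => Real.exp (-(c ^ 2 / 2) * x ^ 2)) := by fun_prop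
    exact Complex.ofRealCLM.contDiff.comp this
  have hint : ∀ k : ℕ, (k : ℕ∞) ≤ ⊤ → Integrable (iteratedDeriv k F) := by
    intro k _
    rw [hF, aux_iter c k]
    exact (aux_poly_integrable hb _).ofReal
  have hFF : 𝓕 F = fun t : ℝ => ((γ * Real.exp (-(π * γ ^ 2) * t ^ 2) : ℝ) : ℂ) := by
    have h := fourier_gaussian_pi (b := ((1 / γ ^ 2 : ℝ) : ℂ)) (by
      rw [Complex.ofReal_re]; positivity)
    have e : F = fun x : ℝ => Complex.exp (-π * ((1 / γ ^ 2 : ℝ) : ℂ) * x ^ 2) := by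
      funext x
      rw [hF]
      simp only [Complex.ofReal_exp, hc2]
      congr 1
      push_cast
      ring
    rw [e, h]
    funext t
    have h1 : (((1 / γ ^ 2 : ℝ) : ℂ)) ^ (1 / 2 : ℂ) = ((1 / γ : ℝ) : ℂ) := by
      have : (1 / 2 : ℂ) = ((1 / 2 : ℝ) : ℂ) := by push_cast; rfl
      rw [this, ← Complex.ofReal_cpow (by positivity), ← Real.sqrt_eq_rpow]
      congr 1
      rw [Real.sqrt_div zero_le_one, Real.sqrt_sq hγ.le, Real.sqrt_one]
    rw [h1]
    push_cast
    have : (γ : ℂ) ≠ 0 := by exact_mod_cast hγ.ne'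
    congr 1
    · field_simp
    · congr 1
      field_simp
  have hFG := Real.fourier_iteratedDeriv (n := 2 * m) hFcd hint le_top
  rw [hG, hFF] at hFG
  have hFG' : 𝓕 (fun x : ℝ => ((Q.eval x * Real.exp (-(c ^ 2 / 2) * x ^ 2) : ℝ) : ℂ)) =
      fun t : ℝ => (((Polynomial.monomial (2 * m) ((-1) ^ m * (2 * π) ^ (2 * m) * γ)).eval t *
        Real.exp (-(π * γ ^ 2) * t ^ 2) : ℝ) : ℂ) := by
    rw [hFG]
    funext t
    simp only [Polynomial.eval_monomial, smul_eq_mul]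
    push_cast
    rw [mul_pow, mul_pow _ Complex.I, pow_mul Complex.I, Complex.I_sq]
    ring
  have hdec := aux_poly_decay hB (Polynomial.monomial (2 * m) ((-1) ^ m * (2 * π) ^ (2 * m) * γ))
  have hP := Real.tsum_eq_tsum_fourier_of_rpow_decay
    (f := fun x : ℝ => ((Q.eval x * Real.exp (-(c ^ 2 / 2) * x ^ 2) : ℝ) : ℂ))
    (by fun_prop) one_lt_two
    (by
      refine IsBigO.of_norm_left ?_
      simp only [Complex.norm_real]
      exact (aux_poly_decay hb Q).norm_left)
    (by
      rw [hFG']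
      refine IsBigO.of_norm_left ?_
      simp only [Complex.norm_real]
      exact hdec.norm_left) 0
  rw [hFG'] at hP
  constructor
  · have h := aux_poly_decay hB (Polynomial.monomial (2 * m) 1)
    have := summable_of_isBigO (Real.summable_abs_int_rpow one_lt_two)
      (h.comp_tendsto Int.tendsto_coe_cofinite)
    simpa [Function.comp_def] using this
  · simp only [zero_add, QuotientAddGroup.mk_zero, fourier_eval_zero, mul_one] at hP
    rw [← Complex.ofReal_tsum, ← Complex.ofReal_tsum, Complex.ofReal_inj] at hP
    simp only [Polynomial.eval_monomial, hQ, Polynomial.eval_mul, Polynomial.eval_C,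
      Polynomial.eval_comp, Polynomial.eval_X, mul_assoc] at hP
    simp only [tsum_mul_left] at hP
    have hcm : (-c) ^ (2 * m) = (2 * π) ^ m / γ ^ (2 * m) := by
      rw [pow_mul, neg_sq, hc2, div_pow, ← pow_mul]
    have hL : ∑' j : ℤ, ((Polynomial.hermite (2 * m)).map (Int.castRingHom ℝ)).eval
        (√(2 * π) * ((j : ℝ) / γ)) * Real.exp (-π * ((j : ℝ) / γ) ^ 2) =
        ∑' j : ℤ, ((Polynomial.hermite (2 * m)).map (Int.castRingHom ℝ)).eval (c * (j : ℝ)) *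
          Real.exp (-(c ^ 2 / 2) * (j : ℝ) ^ 2) := by
      refine tsum_congr fun j => ?_
      congr 2
      · rw [hc]; ring
      · rw [hc2]; field_simp
    rw [hL]
    rw [hcm] at hP
    simp only [← mul_assoc] at hP ⊢
    have h0 : (2 * π) ^ m / γ ^ (2 * m) ≠ 0 := by positivity
    apply mul_left_cancel₀ h0
    rw [hP]
    rw [show (2 * π) ^ (2 * m) = (2 * π) ^ m * (2 * π) ^ m by rw [← pow_add]; ring_nf]
    field_simp

lemma aux_theta {γ : ℝ} (hγ : 1 < γ) :
    ∑' j : ℤ, Real.exp (-(π * γ ^ 2) * (j : ℝ) ^ 2) ≤ 2 := by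
  have hπ := Real.pi_gt_three
  have him : (Complex.I * ((γ ^ 2 : ℝ) : ℂ)).im = γ ^ 2 := by
    rw [mul_comm, Complex.im_ofReal_mul]; simp
  have hg : 1 < γ ^ 2 := by nlinarith
  have h := norm_jacobiTheta_sub_one_le (τ := Complex.I * ((γ ^ 2 : ℝ) : ℂ)) (by
    rw [him]; positivity)
  rw [him] at h
  have e : jacobiTheta (Complex.I * ((γ ^ 2 : ℝ) : ℂ)) =
      ((∑' j : ℤ, Real.exp (-(π * γ ^ 2) * (j : ℝ) ^ 2) : ℝ) : ℂ) := by
    rw [jacobiTheta, Complex.ofReal_tsum]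
    refine tsum_congr fun j => ?_
    rw [Complex.ofReal_exp]
    congr 1
    push_cast
    linear_combination (π * (j : ℂ) ^ 2 * γ ^ 2) * Complex.I_sq
  rw [e, ← Complex.ofReal_one, ← Complex.ofReal_sub, Complex.norm_real] at h
  have hq : Real.exp (-π * γ ^ 2) ≤ 1 / 4 := by
    rw [neg_mul, Real.exp_neg, ← one_div]
    apply one_div_le_one_div_of_le (by norm_num)
    have := Real.add_one_le_exp (π * γ ^ 2)
    nlinarith
  have hq0 := Real.exp_pos (-π * γ ^ 2)
  have h2 : 2 / (1 - Real.exp (-π * γ ^ 2)) * Real.exp (-π * γ ^ 2) ≤ 1 := by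
    rw [div_mul_eq_mul_div, div_le_one (by linarith)]
    linarith
  have := (le_abs_self _).trans (h.trans h2)
  linarith

lemma aux_stirling (n : ℕ) (hn : n ≠ 0) :
    (n.factorial : ℝ) ≤ Real.exp 1 * √n * (n / Real.exp 1) ^ n := by
  obtain ⟨k, rfl⟩ := Nat.exists_eq_succ_of_ne_zero hn
  have h := Stirling.stirlingSeq'_antitone (Nat.zero_le k)
  simp only [Function.comp_apply, Nat.succ_eq_add_one, zero_add, Stirling.stirlingSeq_one] at h
  rw [Stirling.stirlingSeq, div_le_iff₀ (by positivity), Real.sqrt_mul (by norm_num)] at h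
  refine h.trans (le_of_eq ?_)
  have : √(2 : ℝ) ≠ 0 := by positivity
  field_simp

lemma aux_exp {α : ℝ} (h0 : 0 ≤ α) (h1 : α ≤ 1) : Real.exp (2 * α) ≤ Real.exp 1 * (1 + α) ^ 2 := by
  have he := Real.exp_one_lt_three
  have hp := Real.exp_pos 1
  have a := Real.add_one_le_exp (2 - 2 * α)
  have b : Real.exp (2 * α) * Real.exp (2 - 2 * α) = Real.exp 1 * Real.exp 1 := by
    rw [← Real.exp_add, ← Real.exp_add]; ring_nf
  have hx := Real.exp_pos (2 * α)
  have c : Real.exp (2 * α) * (3 - 2 * α) ≤ Real.exp 1 * 3 := by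
    nlinarith
  have d : (3 : ℝ) ≤ (1 + α) ^ 2 * (3 - 2 * α) := by nlinarith [mul_nonneg h0 (sub_nonneg.2 h1), mul_nonneg (mul_nonneg h0 h0) (sub_nonneg.2 h1)]
  have e : Real.exp (2 * α) * (3 - 2 * α) ≤ Real.exp 1 * (1 + α) ^ 2 * (3 - 2 * α) := by nlinarith
  exact le_of_mul_le_mul_right e (by linarith)

lemma aux_bound {s : ℝ} (hs : 1 < s) :
    ((2 * ⌊π * s ^ 2⌋₊).factorial : ℝ) ≤ Real.exp 1 ^ 2 * (2 * π * s) *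
      ((2 * (π * s ^ 2)) ^ ⌊π * s ^ 2⌋₊ * Real.exp (-(π * s ^ 2))) ^ 2 := by
  have hπ := Real.pi_gt_three
  set T := π * s ^ 2 with hT
  set m := ⌊T⌋₊ with hm
  have hT1 : 1 ≤ T := by nlinarith
  have hm1 : 1 ≤ m := Nat.le_floor (by simpa using hT1)
  have hmT : (m : ℝ) ≤ T := Nat.floor_le (by linarith)
  have hTm : T < m + 1 := Nat.lt_floor_add_one T
  have hmpos : (0 : ℝ) < m := by exact_mod_cast hm1
  have hst := aux_stirling (2 * m) (by omega)
  refine hst.trans ?_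
  push_cast
  have hsq : √(2 * (m : ℝ)) ≤ 2 * π * s := by
    apply Real.sqrt_le_iff.2 ⟨by positivity, ?_⟩
    have : 2 * T ≤ (2 * π * s) ^ 2 := by
      rw [hT]; nlinarith [sq_nonneg s]
    linarith
  have hB : 1 + (T - m) ≤ (T / m) ^ m := by
    have := one_add_mul_le_pow (a := (T - m) / m) (by
      have : 0 ≤ (T - m) / m := div_nonneg (by linarith) hmpos.le
      linarith) m
    have e1 : (m : ℝ) * ((T - m) / m) = T - m := by field_simp
    have e2 : 1 + (T - m) / m = T / m := by field_simp; ring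
    rwa [e1, e2] at this
  have hE := aux_exp (α := T - m) (by linarith) (by linarith)
  have key : Real.exp (2 * (T - m)) * (m : ℝ) ^ (2 * m) ≤ Real.exp 1 * T ^ (2 * m) := by
    have h1 : (1 + (T - m)) ^ 2 ≤ ((T / m) ^ m) ^ 2 := by
      have : 0 ≤ 1 + (T - m) := by linarith
      gcongr
    have h2 : Real.exp (2 * (T - m)) ≤ Real.exp 1 * ((T / m) ^ m) ^ 2 :=
      hE.trans (by gcongr)
    calc _ ≤ Real.exp 1 * ((T / m) ^ m) ^ 2 * (m : ℝ) ^ (2 * m) := by gcongr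
      _ = _ := by
        rw [← pow_mul, mul_comm m 2, div_pow]; field_simp
  have hexp : Real.exp (2 * (T - m)) = Real.exp T ^ 2 / Real.exp 1 ^ (2 * m) := by
    rw [← Real.exp_nat_mul, ← Real.exp_nat_mul, ← Real.exp_sub]
    congr 1; push_cast; ring
  rw [hexp] at key
  have key2 : (2 * (m : ℝ) / Real.exp 1) ^ (2 * m) ≤
      Real.exp 1 * ((2 * T) ^ m * Real.exp (-T)) ^ 2 := by
    have hTp := Real.exp_pos T
    have e3 : Real.exp 1 * ((2 * T) ^ m * Real.exp (-T)) ^ 2 =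
        2 ^ (2 * m) / Real.exp T ^ 2 * (Real.exp 1 * T ^ (2 * m)) := by
      rw [Real.exp_neg, mul_pow, mul_pow, mul_pow, ← pow_mul, ← pow_mul, mul_comm m 2]; field_simp
    rw [e3]
    refine le_trans (le_of_eq ?_) (mul_le_mul_of_nonneg_left key (by positivity))
    rw [div_pow, mul_pow]
    field_simp
  calc _ ≤ Real.exp 1 * (2 * π * s) * (Real.exp 1 * ((2 * T) ^ m * Real.exp (-T)) ^ 2) := by
        gcongr
    _ = _ := by ring

theorem discreteGaussian_hermiteCoeff_lower_rounded (γ : ℝ) (hγ : 1 < γ) (ℓ : ℕ) :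
    (1 : ℝ) / (Real.exp 1 * Real.sqrt (2 * Real.pi * ℓ * γ)) ≤
      |∑' j : ℤ, (Real.exp (-Real.pi * ((j : ℝ) / γ) ^ 2) / latticeMass γ) *
        hermiteQ (2 * ⌊(ℓ : ℝ) ^ 2 * Real.pi * γ ^ 2⌋₊) ((j : ℝ) / γ)| := by
  rcases Nat.eq_zero_or_pos ℓ with rfl | hℓ
  · simp
  have hγ0 : 0 < γ := by linarith
  have hπ := Real.pi_pos
  have hl : (1 : ℝ) ≤ ℓ := by exact_mod_cast hℓ
  have hT : (ℓ : ℝ) ^ 2 * Real.pi * γ ^ 2 = π * (ℓ * γ) ^ 2 := by ring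
  rw [hT]
  have hbd := aux_bound (s := ℓ * γ) (by nlinarith)
  set m := ⌊π * (ℓ * γ) ^ 2⌋₊ with hm
  obtain ⟨hsum, hid⟩ := aux_poisson hγ0 m
  obtain ⟨hsum0, hid0⟩ := aux_poisson hγ0 0
  simp at hid0 hsum0
  have hmass : latticeMass γ = γ * ∑' j : ℤ, Real.exp (-(π * γ ^ 2) * (j : ℝ) ^ 2) := by
    rw [latticeMass]
    simpa using hid0
  have hmle : latticeMass γ ≤ 2 * γ := by
    rw [hmass]; nlinarith [aux_theta hγ]
  have hmpos : 0 < latticeMass γ := by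
    rw [hmass]
    apply mul_pos hγ0
    refine Summable.tsum_pos ?_ (fun i => (Real.exp_pos _).le) 0 (Real.exp_pos _)
    simpa using hsum0
  set S := ∑' j : ℤ, (j : ℝ) ^ (2 * m) * Real.exp (-(π * γ ^ 2) * (j : ℝ) ^ 2) with hS
  have hSge : 2 * ((ℓ : ℝ) ^ (2 * m) * Real.exp (-(π * (ℓ * γ) ^ 2))) ≤ S := by
    have hne : (ℓ : ℤ) ≠ -(ℓ : ℤ) := by omega
    have := hsum.sum_le_tsum {(ℓ : ℤ), -(ℓ : ℤ)} (fun i _ =>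
      mul_nonneg (by rw [pow_mul]; positivity) (Real.exp_pos _).le)
    rw [Finset.sum_pair hne] at this
    refine le_trans (le_of_eq ?_) this
    push_cast
    rw [pow_mul (-(ℓ : ℝ)), neg_sq, ← pow_mul, two_mul,
      show -(π * γ ^ 2) * (ℓ : ℝ) ^ 2 = -(π * (ℓ * γ) ^ 2) by ring]
  have hf : (0 : ℝ) < ((2 * m).factorial : ℝ) := by positivity
  have hE : ∑' j : ℤ, (Real.exp (-Real.pi * ((j : ℝ) / γ) ^ 2) / latticeMass γ) *
        hermiteQ (2 * m) ((j : ℝ) / γ) = (-1) ^ m * ((2 * π) ^ m * γ * γ ^ (2 * m) * S /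
          (latticeMass γ * √((2 * m).factorial : ℝ))) := by
    have : ∀ j : ℤ, (Real.exp (-Real.pi * ((j : ℝ) / γ) ^ 2) / latticeMass γ) *
        hermiteQ (2 * m) ((j : ℝ) / γ) = (1 / (latticeMass γ * √((2 * m).factorial : ℝ))) *
        (((Polynomial.hermite (2 * m)).map (Int.castRingHom ℝ)).eval
        (√(2 * π) * ((j : ℝ) / γ)) * Real.exp (-π * ((j : ℝ) / γ) ^ 2)) := by
      intro j
      rw [hermiteQ]
      field_simp
    simp only [this]
    rw [tsum_mul_left, hid]
    ring
  have hS0 : 0 ≤ S := le_trans (by positivity) hSge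
  rw [hE, abs_mul, abs_pow, abs_neg, abs_one, one_pow, one_mul, abs_of_nonneg (by positivity)]
  set W := (2 * (π * (ℓ * γ) ^ 2)) ^ m * Real.exp (-(π * (ℓ * γ) ^ 2)) with hW
  have hW0 : 0 < W := by positivity
  have hfs : √((2 * m).factorial : ℝ) ≤ Real.exp 1 * √(2 * π * ℓ * γ) * W := by
    apply Real.sqrt_le_iff.2 ⟨by positivity, ?_⟩
    rw [mul_pow, mul_pow, Real.sq_sqrt (by positivity)]
    refine hbd.trans (le_of_eq ?_)
    ring
  have hWS : 2 * γ * W ≤ (2 * π) ^ m * γ * γ ^ (2 * m) * S := by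
    calc 2 * γ * W = (2 * π) ^ m * γ * γ ^ (2 * m) *
          (2 * ((ℓ : ℝ) ^ (2 * m) * Real.exp (-(π * (ℓ * γ) ^ 2)))) := by
          rw [hW, ← mul_assoc 2 π, mul_pow (2 * π), ← pow_mul, mul_pow (ℓ : ℝ)]; ring
      _ ≤ _ := by gcongr
  rw [div_le_div_iff₀ (by positivity) (by positivity), one_mul]
  calc latticeMass γ * √((2 * m).factorial : ℝ) ≤
      (2 * γ) * (Real.exp 1 * √(2 * π * ℓ * γ) * W) := by gcongr
    _ = (2 * γ * W) * (Real.exp 1 * √(2 * π * ℓ * γ)) := by ring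
    _ ≤ _ := by gcongr
end
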